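/- Let n ≥ 3, let F be a finite field of characteristic p. Suppose D is a nontrivial 2-(v,k,λ) design with prime replication number r, G is a flag-transitive automorphism group of D which is almost simple with socle X isomorphic to PSL_n(F), and α is a point of D. Then r divides the p′-part of |G_α ∩ X| (the largest divisor of |G_α ∩ X| coprime to p), and consequently |X| < |G_α ∩ X| · (|G_α ∩ X|_{p′})², where m_{p′} denotes the p′-part of the integer m. -/

import Mathlib

open Pointwise

variable {P : Type*}

/-- `blocks` is the block set of a 2-(v,k,lam) design on the point set `P`:
`P` has `v ≥ 2` points, every block is a `k`-subset of `P`, and every pair of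
distinct points lies in exactly `lam ≥ 1` common blocks. -/
def IsTwoDesign [Fintype P] [DecidableEq P] (blocks : Finset (Finset P))
    (v k lam : ℕ) : Prop :=
  Fintype.card P = v ∧ 2 ≤ v ∧ 1 ≤ lam ∧
    (∀ B ∈ blocks, B.card = k) ∧
    ∀ x y : P, x ≠ y → (blocks.filter fun B => x ∈ B ∧ y ∈ B).card = lam

/-- The number of blocks containing a given point `x`. -/
def pointDegree [DecidableEq P] (blocks : Finset (Finset P)) (x : P) : ℕ :=
  (blocks.filter fun B => x ∈ B).card

/-- `G` is a group of automorphisms of the design with block set `blocks`: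
every element of `G` is a permutation of the points mapping blocks to blocks. -/
def IsAutGroup [DecidableEq P] (blocks : Finset (Finset P))
    (G : Subgroup (Equiv.Perm P)) : Prop :=
  ∀ g ∈ G, ∀ B ∈ blocks, B.image g ∈ blocks

/-- `G` acts transitively on the flags (incident point-block pairs) of the design. -/
def IsFlagTransitive [DecidableEq P] (blocks : Finset (Finset P))
    (G : Subgroup (Equiv.Perm P)) : Prop :=
  ∀ B₁ ∈ blocks, ∀ B₂ ∈ blocks, ∀ x₁ ∈ B₁, ∀ x₂ ∈ B₂,
    ∃ g ∈ G, g x₁ = x₂ ∧ B₁.image g = B₂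

/-- The `p′`-part of a natural number `m`: the largest divisor of `m` coprime to `p`. -/
def pPrimePart (p m : ℕ) : ℕ := m / p ^ (m.factorization p)

namespace PSLAux

open Matrix

section Vec

variable {n : ℕ} {F : Type*} [Field F]

/-- two nonzero-scalar multiples -/
def Par (u w : Fin n → F) : Prop := ∃ c : F, c ≠ 0 ∧ w = c • u

lemma Par.symm {u w : Fin n → F} (h : Par u w) : Par w u := by
  obtain ⟨c, hc, rfl⟩ := h
  exact ⟨c⁻¹, inv_ne_zero hc, by rw [smul_smul, inv_mul_cancel₀ hc, one_smul]⟩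

lemma Par.trans {u w z : Fin n → F} (h : Par u w) (h' : Par w z) : Par u z := by
  obtain ⟨c, hc, rfl⟩ := h
  obtain ⟨d, hd, rfl⟩ := h'
  exact ⟨d * c, mul_ne_zero hd hc, by rw [smul_smul]⟩

lemma Par.refl (u : Fin n → F) : Par u u := ⟨1, one_ne_zero, by simp⟩

/-- double annihilator for two vectors -/
lemma dbl_ann (x y z : Fin n → F)
    (h : ∀ g : Fin n → F, g ⬝ᵥ x = 0 → g ⬝ᵥ y = 0 → g ⬝ᵥ z = 0) :
    ∃ a b : F, z = a • x + b • y := by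
  let L : Fin 2 → ((Fin n → F) →ₗ[F] F) := ![dotProductBilin F F x, dotProductBilin F F y]
  have := mem_span_of_iInf_ker_le_ker (L := L) (K := dotProductBilin F F z) (by
    intro g hg
    rw [Submodule.mem_iInf] at hg
    have h0 := hg 0
    have h1 := hg 1
    simp only [L, LinearMap.mem_ker, cons_val_zero, cons_val_one, dotProductBilin_apply_apply] at h0 h1 ⊢
    rw [dotProduct_comm] at h0 h1 ⊢
    exact h g h0 h1)
  have hr : Set.range L = {dotProductBilin F F x, dotProductBilin F F y} := by
    simp [L, Matrix.range_cons, Set.pair_comm]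
  rw [hr, Submodule.mem_span_pair] at this
  obtain ⟨a, b, hab⟩ := this
  refine ⟨a, b, ?_⟩
  funext i
  have := LinearMap.congr_fun hab (Pi.single i 1)
  simp only [LinearMap.add_apply, LinearMap.smul_apply, dotProductBilin_apply_apply,
    dotProduct_single, mul_one] at this
  simpa using this.symm

lemma sep (f f' : Fin n → F) (hf : f ≠ 0) (h : ¬ Par f' f) :
    ∃ x : Fin n → F, f' ⬝ᵥ x = 0 ∧ f ⬝ᵥ x = 1 := by
  by_contra hcon
  push Not at hcon
  have key : ∀ g : Fin n → F, f' ⬝ᵥ g = 0 → f ⬝ᵥ g = 0 := by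
    intro g hg
    by_contra hne
    refine hcon ((f ⬝ᵥ g)⁻¹ • g) ?_ ?_
    · rw [dotProduct_smul, hg, smul_zero]
    · rw [dotProduct_smul, smul_eq_mul, inv_mul_cancel₀ hne]
  obtain ⟨a, b, hab⟩ := dbl_ann f' f' f (fun g h1 _ => by
    rw [dotProduct_comm] at h1 ⊢; exact key g h1)
  rw [← add_smul] at hab
  refine h ⟨a + b, ?_, hab⟩
  intro h0
  rw [h0, zero_smul] at hab
  exact hf hab

lemma exists_ann (hn : 3 ≤ n) (f g : Fin n → F) :
    ∃ x : Fin n → F, x ≠ 0 ∧ f ⬝ᵥ x = 0 ∧ g ⬝ᵥ x = 0 := by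
  let M : (Fin n → F) →ₗ[F] (F × F) := (dotProductBilin F F f).prod (dotProductBilin F F g)
  have hlt : Module.finrank F (F × F) < Module.finrank F (Fin n → F) := by
    simp; omega
  obtain ⟨x, hx, hx0⟩ := (Submodule.ne_bot_iff _).1 (LinearMap.ker_ne_bot_of_finrank_lt (f := M) hlt)
  rw [LinearMap.mem_ker] at hx
  refine ⟨x, hx0, ?_, ?_⟩
  · simpa [M] using congrArg Prod.fst hx
  · simpa [M] using congrArg Prod.snd hx

lemma exists_ann' (hn : 3 ≤ n) (u w : Fin n → F) :
    ∃ f : Fin n → F, f ≠ 0 ∧ f ⬝ᵥ u = 0 ∧ f ⬝ᵥ w = 0 := by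
  obtain ⟨x, h0, h1, h2⟩ := exists_ann hn u w
  exact ⟨x, h0, by rw [dotProduct_comm]; exact h1, by rw [dotProduct_comm]; exact h2⟩

lemma exists_ann_not_par (hn : 3 ≤ n) (u f : Fin n → F) (hf : f ≠ 0) :
    ∃ g : Fin n → F, g ≠ 0 ∧ g ⬝ᵥ u = 0 ∧ ¬ Par f g := by
  obtain ⟨i, hi⟩ := Function.ne_iff.1 hf
  obtain ⟨g, hg0, hgu, hgi⟩ := exists_ann' hn u (Pi.single i 1)
  refine ⟨g, hg0, hgu, ?_⟩
  rintro ⟨c, hc, rfl⟩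
  simp at hgi
  exact hgi.elim hc (by simpa using hi)

lemma vm_par {u f u' f' : Fin n → F} (hu : u ≠ 0) (hf : f ≠ 0)
    (h : vecMulVec u f = vecMulVec u' f') : Par u u' ∧ Par f f' := by
  obtain ⟨i, hi⟩ := Function.ne_iff.1 hu
  obtain ⟨j, hj⟩ := Function.ne_iff.1 hf
  simp only [Pi.zero_apply] at hi hj
  have e : ∀ a b, u a * f b = u' a * f' b := fun a b => by
    simpa [vecMulVec_apply] using congrFun (congrFun h a) b
  have hij : u' i * f' j ≠ 0 := by rw [← e]; exact mul_ne_zero hi hj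
  have hi' : u' i ≠ 0 := left_ne_zero_of_mul hij
  have hj' : f' j ≠ 0 := right_ne_zero_of_mul hij
  constructor
  · refine Par.symm ⟨f' j / f j, div_ne_zero hj' hj, ?_⟩
    funext a
    simp only [Pi.smul_apply, smul_eq_mul]
    field_simp
    rw [e, mul_comm]
  · refine Par.symm ⟨u' i / u i, div_ne_zero hi' hi, ?_⟩
    funext a
    simp only [Pi.smul_apply, smul_eq_mul]
    field_simp
    rw [mul_comm, e]

end Vec

section Tv

variable {n : ℕ} {F : Type*} [Field F]

lemma sl_ext {g h : Matrix.SpecialLinearGroup (Fin n) F}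
    (e : (g : Matrix (Fin n) (Fin n) F) = (h : Matrix (Fin n) (Fin n) F)) : g = h := Subtype.ext e

/-- transvection `1 + u f`. -/
def tv (u f : Fin n → F) (h : f ⬝ᵥ u = 0) : Matrix.SpecialLinearGroup (Fin n) F :=
  ⟨1 + vecMulVec u f, by
    rw [vecMulVec_eq Unit, det_one_add_replicateCol_mul_replicateRow, h, add_zero]⟩

lemma tv_coe (u f : Fin n → F) (h : f ⬝ᵥ u = 0) :
    (tv u f h : Matrix (Fin n) (Fin n) F) = 1 + vecMulVec u f := rfl

lemma tv_mulVec (u f : Fin n → F) (h : f ⬝ᵥ u = 0) (x : Fin n → F) :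
    (tv u f h : Matrix (Fin n) (Fin n) F) *ᵥ x = x + (f ⬝ᵥ x) • u := by
  rw [tv_coe, add_mulVec, one_mulVec, vecMulVec_mulVec]
  simp

lemma tv_mul_left (u f g : Fin n → F) (hf : f ⬝ᵥ u = 0) (hg : g ⬝ᵥ u = 0) :
    tv u f hf * tv u g hg = tv u (f + g) (by rw [add_dotProduct, hf, hg, add_zero]) := by
  apply sl_ext
  rw [Matrix.SpecialLinearGroup.coe_mul, tv_coe, tv_coe, tv_coe, add_mul, mul_add, mul_add,
    vecMulVec_mul_vecMulVec, hf, vecMulVec_add]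
  simp [add_assoc, add_comm, add_left_comm]

lemma tv_mul_right (u w f : Fin n → F) (hf : f ⬝ᵥ u = 0) (hg : f ⬝ᵥ w = 0) :
    tv u f hf * tv w f hg = tv (u + w) f (by rw [dotProduct_add, hf, hg, add_zero]) := by
  apply sl_ext
  rw [Matrix.SpecialLinearGroup.coe_mul, tv_coe, tv_coe, tv_coe, add_mul, mul_add, mul_add,
    vecMulVec_mul_vecMulVec, hg, add_vecMulVec]
  simp [add_assoc, add_comm, add_left_comm]

lemma tv_zero_right (u : Fin n → F) : tv u 0 (by simp) = 1 := by
  apply sl_ext; simp [tv_coe]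

lemma tv_zero_left (f : Fin n → F) : tv 0 f (by simp) = 1 := by
  apply sl_ext; simp [tv_coe]

lemma tv_congr {u f u' f' : Fin n → F} (h : f ⬝ᵥ u = 0) (h' : f' ⬝ᵥ u' = 0)
    (e : vecMulVec u f = vecMulVec u' f') : tv u f h = tv u' f' h' := by
  apply sl_ext; rw [tv_coe, tv_coe, e]

lemma conj_ok (g : Matrix.SpecialLinearGroup (Fin n) F) (u f : Fin n → F) (h : f ⬝ᵥ u = 0) :
    (f ᵥ* ((g⁻¹ : Matrix.SpecialLinearGroup (Fin n) F) : Matrix (Fin n) (Fin n) F)) ⬝ᵥ ((g : Matrix (Fin n) (Fin n) F) *ᵥ u) = 0 := by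
  rw [← dotProduct_mulVec, mulVec_mulVec, ← Matrix.SpecialLinearGroup.coe_mul, inv_mul_cancel]
  simpa using h

lemma tv_conj (g : Matrix.SpecialLinearGroup (Fin n) F) (u f : Fin n → F) (h : f ⬝ᵥ u = 0) :
    g * tv u f h * g⁻¹ =
      tv ((g : Matrix (Fin n) (Fin n) F) *ᵥ u) (f ᵥ* ((g⁻¹ : Matrix.SpecialLinearGroup (Fin n) F) : Matrix (Fin n) (Fin n) F)) (conj_ok g u f h) := by
  apply sl_ext
  rw [Matrix.SpecialLinearGroup.coe_mul, Matrix.SpecialLinearGroup.coe_mul, tv_coe, tv_coe, mul_add, add_mul,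
    mul_one, ← Matrix.SpecialLinearGroup.coe_mul, mul_inv_cancel, mul_vecMulVec, vecMulVec_mul]
  rfl

/-- The projective group. -/
abbrev PS (n : ℕ) (F : Type*) [Field F] :=
  Matrix.SpecialLinearGroup (Fin n) F ⧸ Subgroup.center (Matrix.SpecialLinearGroup (Fin n) F)

/-- The quotient map. -/
def pr : Matrix.SpecialLinearGroup (Fin n) F →* PS n F := QuotientGroup.mk' _

lemma pr_surj : Function.Surjective (pr : Matrix.SpecialLinearGroup (Fin n) F →* PS n F) :=
  QuotientGroup.mk'_surjective _

lemma pr_eq_iff (g h : Matrix.SpecialLinearGroup (Fin n) F) :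
    pr g = pr h ↔ ∃ a : F, (h : Matrix (Fin n) (Fin n) F) = a • (g : Matrix (Fin n) (Fin n) F) := by
  unfold pr
  rw [QuotientGroup.mk'_apply, QuotientGroup.mk'_apply, QuotientGroup.eq]
  constructor
  · intro hc
    obtain ⟨a, _, ha⟩ := Matrix.SpecialLinearGroup.mem_center_iff.1 hc
    refine ⟨a, ?_⟩
    have : h = g * (g⁻¹ * h) := by group
    rw [this, Matrix.SpecialLinearGroup.coe_mul, ← ha]
    simp [← Matrix.smul_one_eq_diagonal]
  · rintro ⟨a, ha⟩
    have hm : ((g⁻¹ * h : Matrix.SpecialLinearGroup (Fin n) F) : Matrix (Fin n) (Fin n) F) = scalar (Fin n) a := by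
      rw [Matrix.SpecialLinearGroup.coe_mul, ha, mul_smul_comm, ← Matrix.SpecialLinearGroup.coe_mul,
        inv_mul_cancel]
      simp [Matrix.smul_one_eq_diagonal]
    refine Matrix.SpecialLinearGroup.mem_center_iff.2 ⟨a, ?_, hm.symm⟩
    have hd := (g⁻¹ * h).det_coe
    rw [hm] at hd
    simpa using hd

lemma pr_tv_inj (hn : 3 ≤ n) {u f u' f' : Fin n → F} {h : f ⬝ᵥ u = 0} {h' : f' ⬝ᵥ u' = 0}
    (e : pr (tv u f h) = pr (tv u' f' h')) : vecMulVec u f = vecMulVec u' f' := by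
  obtain ⟨a, ha⟩ := (pr_eq_iff _ _).1 e
  obtain ⟨x, hx0, h1, h2⟩ := exists_ann hn f f'
  have hx := congrArg (· *ᵥ x) ha
  simp only [smul_mulVec, tv_mulVec, h1, h2, zero_smul, add_zero] at hx
  have ha1 : a = 1 := by
    by_contra hne
    have : (1 - a) • x = 0 := by rw [sub_smul, one_smul, ← hx, sub_self]
    rcases smul_eq_zero.1 this with h | h
    · exact hne (sub_eq_zero.1 h).symm
    · exact hx0 h
  rw [ha1, one_smul, tv_coe, tv_coe] at ha
  exact (add_left_cancel ha).symm

lemma pr_tv_mul (hn : 3 ≤ n) {u f u' f' u'' f'' : Fin n → F} {h : f ⬝ᵥ u = 0}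
    {h' : f' ⬝ᵥ u' = 0} {h'' : f'' ⬝ᵥ u'' = 0} (hu : u ≠ 0) (hf : f ≠ 0) (hu' : u' ≠ 0)
    (hf' : f' ≠ 0)
    (e : pr (tv u f h) * pr (tv u' f' h') = pr (tv u'' f'' h'')) : Par u u' ∨ Par f f' := by
  rw [← map_mul] at e
  obtain ⟨a, ha⟩ := (pr_eq_iff _ _).1 e
  have hv : ∀ x, x + (f'' ⬝ᵥ x) • u'' =
      a • (x + (f' ⬝ᵥ x) • u' + (f ⬝ᵥ x + (f' ⬝ᵥ x) * (f ⬝ᵥ u')) • u) := by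
    intro x
    have hx := congrArg (· *ᵥ x) ha
    simp only [Matrix.SpecialLinearGroup.coe_mul, smul_mulVec, ← mulVec_mulVec, tv_mulVec, dotProduct_add,
      dotProduct_smul, smul_eq_mul] at hx
    exact hx
  have ha1 : a = 1 := by
    obtain ⟨x, hx0, h1, h2⟩ := exists_ann hn f f'
    have hx := hv x
    simp only [h1, h2, zero_smul, add_zero, zero_mul] at hx
    have h3 : f'' ⬝ᵥ x = a * (f'' ⬝ᵥ x) := by
      have := congrArg (f'' ⬝ᵥ ·) hx
      simpa [dotProduct_add, dotProduct_smul, h''] using this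
    by_contra hne
    have h4 : f'' ⬝ᵥ x = 0 := by
      have : (1 - a) * (f'' ⬝ᵥ x) = 0 := by rw [sub_mul, one_mul, ← h3, sub_self]
      rcases mul_eq_zero.1 this with h | h
      · exact absurd (sub_eq_zero.1 h).symm hne
      · exact h
    rw [h4, zero_smul, add_zero] at hx
    have : (1 - a) • x = 0 := by rw [sub_smul, one_smul, ← hx, sub_self]
    rcases smul_eq_zero.1 this with h | h
    · exact hne (sub_eq_zero.1 h).symm
    · exact hx0 h
  subst ha1
  have hv' : ∀ x, (f'' ⬝ᵥ x) • u'' =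
      (f' ⬝ᵥ x) • u' + (f ⬝ᵥ x + (f' ⬝ᵥ x) * (f ⬝ᵥ u')) • u := by
    intro x
    have := hv x
    rw [one_smul, add_assoc] at this
    exact add_left_cancel this
  by_contra hcon
  push Not at hcon
  obtain ⟨hpu, hpf⟩ := hcon
  obtain ⟨x, hx1, hx2⟩ := sep f f' hf (fun hp => hpf hp.symm)
  obtain ⟨y, hy1, hy2⟩ := sep f' f hf' hpf
  have e1 := hv' x
  have e2 := hv' y
  simp only [hx1, hx2, zero_smul, zero_mul, add_zero, one_smul, zero_add] at e1
  simp only [hy1, hy2, one_smul, one_mul, zero_add] at e2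
  have hne : f'' ⬝ᵥ x ≠ 0 := by
    intro h0
    rw [h0, zero_smul] at e1
    exact hu e1.symm
  have hu2 : u'' = (f'' ⬝ᵥ x)⁻¹ • u := by
    rw [← e1, smul_smul, inv_mul_cancel₀ hne, one_smul]
  have hu3 : u' = ((f'' ⬝ᵥ y) * (f'' ⬝ᵥ x)⁻¹ - f ⬝ᵥ u') • u := by
    rw [sub_smul, ← smul_smul, ← hu2, e2, add_sub_cancel_right]
  refine hpu ⟨_, ?_, hu3⟩
  intro h0
  rw [h0, zero_smul] at hu3
  exact hu' hu3

lemma pr_tv_ne_one (hn : 3 ≤ n) {u f : Fin n → F} {h : f ⬝ᵥ u = 0} (hu : u ≠ 0) (hf : f ≠ 0) :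
    pr (tv u f h) ≠ 1 := by
  intro e
  rw [← map_one pr, ← tv_zero_right (0 : Fin n → F)] at e
  have := (vm_par hu hf (pr_tv_inj hn e)).1.symm
  obtain ⟨c, _, hc⟩ := this
  exact hu (by simpa using hc)

end Tv


section Roots

variable {n : ℕ} {F : Type*} [Field F]

lemma tv_isConj_same_u {u f f' : Fin n → F} (h : f ⬝ᵥ u = 0) (h' : f' ⬝ᵥ u = 0)
    (hf : f ≠ 0) (hf' : f' ≠ 0) (hp : ¬ Par f f') : IsConj (tv u f h) (tv u f' h') := by
  obtain ⟨x, hx1, hx2⟩ := sep f f' hf (fun hp' => hp hp'.symm)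
  obtain ⟨y, hy1, hy2⟩ := sep f' f hf' hp
  have e1 : f ⬝ᵥ (x + y) = 1 := by rw [dotProduct_add, hx2, hy1, add_zero]
  have e2 : f' ⬝ᵥ (x + y) = 1 := by rw [dotProduct_add, hx1, hy2, zero_add]
  have e3 : (f - f') ⬝ᵥ (x + y) = 0 := by rw [sub_dotProduct, e1, e2, sub_self]
  have e4 : (f - f') ⬝ᵥ u = 0 := by rw [sub_dotProduct, h, h', sub_self]
  rw [isConj_iff]
  refine ⟨tv (x + y) (f - f') e3, ?_⟩
  rw [mul_inv_eq_iff_eq_mul]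
  apply sl_ext
  rw [Matrix.SpecialLinearGroup.coe_mul, Matrix.SpecialLinearGroup.coe_mul, tv_coe, tv_coe, tv_coe,
    add_mul, mul_add, mul_add, add_mul, mul_add, mul_add, vecMulVec_mul_vecMulVec,
    vecMulVec_mul_vecMulVec, e4, e2, one_smul, vecMulVec_sub u]
  simp only [one_mul, mul_one, zero_smul, vecMulVec_zero]
  abel

lemma tv_isConj_same_f {u u' f : Fin n → F} (h : f ⬝ᵥ u = 0) (h' : f ⬝ᵥ u' = 0)
    (hu : u ≠ 0) (hu' : u' ≠ 0) (hp : ¬ Par u u') : IsConj (tv u f h) (tv u' f h') := by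
  obtain ⟨x, hx1, hx2⟩ := sep u u' hu (fun hp' => hp hp'.symm)
  obtain ⟨y, hy1, hy2⟩ := sep u' u hu' hp
  rw [dotProduct_comm] at hx1 hx2 hy1 hy2
  have e1 : (x + y) ⬝ᵥ u = 1 := by rw [add_dotProduct, hx2, hy1, add_zero]
  have e2 : (x + y) ⬝ᵥ u' = 1 := by rw [add_dotProduct, hx1, hy2, zero_add]
  have e3 : (x + y) ⬝ᵥ (u' - u) = 0 := by rw [dotProduct_sub, e1, e2, sub_self]
  have e4 : f ⬝ᵥ (u' - u) = 0 := by rw [dotProduct_sub, h, h', sub_self]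
  rw [isConj_iff]
  refine ⟨tv (u' - u) (x + y) e3, ?_⟩
  rw [mul_inv_eq_iff_eq_mul]
  apply sl_ext
  rw [Matrix.SpecialLinearGroup.coe_mul, Matrix.SpecialLinearGroup.coe_mul, tv_coe, tv_coe, tv_coe,
    add_mul, mul_add, mul_add, add_mul, mul_add, mul_add, vecMulVec_mul_vecMulVec,
    vecMulVec_mul_vecMulVec, e4, e1, one_smul, sub_vecMulVec u' u f]
  simp only [one_mul, mul_one, zero_smul, vecMulVec_zero]
  abel

lemma tv_isConj_same_u' (hn : 3 ≤ n) {u f f' : Fin n → F} (h : f ⬝ᵥ u = 0) (h' : f' ⬝ᵥ u = 0)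
    (hf : f ≠ 0) (hf' : f' ≠ 0) : IsConj (tv u f h) (tv u f' h') := by
  by_cases hp : Par f f'
  · obtain ⟨g, hg0, hgu, hpg⟩ := exists_ann_not_par hn u f hf
    refine (tv_isConj_same_u h hgu hf hg0 hpg).trans (tv_isConj_same_u hgu h' hg0 hf' ?_)
    exact fun hq => hpg (hp.trans hq.symm)
  · exact tv_isConj_same_u h h' hf hf' hp

lemma tv_isConj_same_f' (hn : 3 ≤ n) {u u' f : Fin n → F} (h : f ⬝ᵥ u = 0) (h' : f ⬝ᵥ u' = 0)
    (hu : u ≠ 0) (hu' : u' ≠ 0) : IsConj (tv u f h) (tv u' f h') := by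
  by_cases hp : Par u u'
  · obtain ⟨g, hg0, hgu, hpg⟩ := exists_ann_not_par hn f u hu
    rw [dotProduct_comm] at hgu
    refine (tv_isConj_same_f h hgu hu hg0 hpg).trans (tv_isConj_same_f hgu h' hg0 hu' ?_)
    exact fun hq => hpg (hp.trans hq.symm)
  · exact tv_isConj_same_f h h' hu hu' hp

lemma tv_isConj (hn : 3 ≤ n) {u u' f f' : Fin n → F} (h : f ⬝ᵥ u = 0) (h' : f' ⬝ᵥ u' = 0)
    (hu : u ≠ 0) (hu' : u' ≠ 0) (hf : f ≠ 0) (hf' : f' ≠ 0) :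
    IsConj (tv u f h) (tv u' f' h') := by
  obtain ⟨g, hg0, hg1, hg2⟩ := exists_ann' hn u u'
  exact (tv_isConj_same_u' hn h hg1 hf hg0).trans
    ((tv_isConj_same_f' hn hg1 hg2 hu hu').trans (tv_isConj_same_u' hn hg2 h' hg0 hf'))

def IsT (x : PS n F) : Prop :=
  ∃ (u f : Fin n → F) (h : f ⬝ᵥ u = 0), u ≠ 0 ∧ f ≠ 0 ∧ x = pr (tv u f h)

lemma IsT.isConj (hn : 3 ≤ n) {x y : PS n F} (hx : IsT x) (hy : IsT y) : IsConj x y := by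
  obtain ⟨u, f, h, hu, hf, rfl⟩ := hx
  obtain ⟨u', f', h', hu', hf', rfl⟩ := hy
  exact MonoidHom.map_isConj pr (tv_isConj hn h h' hu hu' hf hf')

lemma mulVec_ne_zero_sl (g : Matrix.SpecialLinearGroup (Fin n) F) {u : Fin n → F} (hu : u ≠ 0) :
    (g : Matrix (Fin n) (Fin n) F) *ᵥ u ≠ 0 := by
  intro h0
  apply hu
  have := congrArg (((g⁻¹ : Matrix.SpecialLinearGroup (Fin n) F) : Matrix (Fin n) (Fin n) F) *ᵥ ·) h0
  simpa only [mulVec_mulVec, ← Matrix.SpecialLinearGroup.coe_mul, inv_mul_cancel, mulVec_zero,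
    Matrix.SpecialLinearGroup.coe_one, one_mulVec] using this

lemma vecMul_ne_zero_sl (g : Matrix.SpecialLinearGroup (Fin n) F) {u : Fin n → F} (hu : u ≠ 0) :
    u ᵥ* (g : Matrix (Fin n) (Fin n) F) ≠ 0 := by
  intro h0
  apply hu
  have := congrArg (· ᵥ* ((g⁻¹ : Matrix.SpecialLinearGroup (Fin n) F) : Matrix (Fin n) (Fin n) F)) h0
  simpa only [vecMul_vecMul, ← Matrix.SpecialLinearGroup.coe_mul, mul_inv_cancel, zero_vecMul,
    Matrix.SpecialLinearGroup.coe_one, vecMul_one] using this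

lemma IsT.conj {x : PS n F} (hx : IsT x) (g : PS n F) : IsT (g * x * g⁻¹) := by
  obtain ⟨u, f, h, hu, hf, rfl⟩ := hx
  obtain ⟨g, rfl⟩ := pr_surj g
  rw [← map_mul, ← map_inv, ← map_mul, tv_conj]
  exact ⟨_, _, _, mulVec_ne_zero_sl g hu, vecMul_ne_zero_sl _ hf, rfl⟩

lemma IsT.ne_one (hn : 3 ≤ n) {x : PS n F} (hx : IsT x) : x ≠ 1 := by
  obtain ⟨u, f, h, hu, hf, rfl⟩ := hx
  exact pr_tv_ne_one hn hu hf

/-- transvections with given centre -/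
def E (u : Fin n → F) : Subgroup (PS n F) where
  carrier := {x | ∃ (f : Fin n → F) (h : f ⬝ᵥ u = 0), x = pr (tv u f h)}
  mul_mem' := by
    rintro _ _ ⟨f, h, rfl⟩ ⟨g, h', rfl⟩
    exact ⟨_, _, by rw [← map_mul, tv_mul_left]⟩
  one_mem' := ⟨0, by simp, by rw [tv_zero_right, map_one]⟩
  inv_mem' := by
    rintro _ ⟨f, h, rfl⟩
    have h' : (-f) ⬝ᵥ u = 0 := by rw [neg_dotProduct, h, neg_zero]
    refine ⟨-f, h', ?_⟩
    rw [inv_eq_iff_mul_eq_one, ← map_mul, tv_mul_left, ← map_one pr, ← tv_zero_right u]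
    congr 1
    exact tv_congr _ _ (by simp)

/-- transvections with given axis -/
def Ed (f : Fin n → F) : Subgroup (PS n F) where
  carrier := {x | ∃ (u : Fin n → F) (h : f ⬝ᵥ u = 0), x = pr (tv u f h)}
  mul_mem' := by
    rintro _ _ ⟨u, h, rfl⟩ ⟨w, h', rfl⟩
    exact ⟨_, _, by rw [← map_mul, tv_mul_right]⟩
  one_mem' := ⟨0, by simp, by rw [tv_zero_left, map_one]⟩
  inv_mem' := by
    rintro _ ⟨u, h, rfl⟩
    have h' : f ⬝ᵥ (-u) = 0 := by rw [dotProduct_neg, h, neg_zero]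
    refine ⟨-u, h', ?_⟩
    rw [inv_eq_iff_mul_eq_one, ← map_mul, tv_mul_right, ← map_one pr, ← tv_zero_left f]
    congr 1
    exact tv_congr _ _ (by simp)

lemma mem_E {u : Fin n → F} {x : PS n F} :
    x ∈ E u ↔ ∃ (f : Fin n → F) (h : f ⬝ᵥ u = 0), x = pr (tv u f h) := Iff.rfl

lemma mem_Ed {f : Fin n → F} {x : PS n F} :
    x ∈ Ed f ↔ ∃ (u : Fin n → F) (h : f ⬝ᵥ u = 0), x = pr (tv u f h) := Iff.rfl

lemma E_smul (u : Fin n → F) {c : F} (hc : c ≠ 0) : E (c • u) = E u := by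
  apply le_antisymm
  · rintro _ ⟨f, h, rfl⟩
    have h' : f ⬝ᵥ u = 0 := by
      rw [dotProduct_smul] at h
      exact (smul_eq_zero.1 h).resolve_left hc
    refine ⟨c • f, by rw [smul_dotProduct, h', smul_zero], ?_⟩
    congr 1
    apply tv_congr
    ext i j
    simp only [vecMulVec_apply, Pi.smul_apply, smul_eq_mul]
    ring
  · rintro _ ⟨f, h, rfl⟩
    refine ⟨c⁻¹ • f, by rw [smul_dotProduct, dotProduct_smul, h, smul_zero, smul_zero], ?_⟩
    congr 1
    apply tv_congr
    ext i j
    simp only [vecMulVec_apply, Pi.smul_apply, smul_eq_mul]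
    field_simp

lemma Ed_smul (f : Fin n → F) {c : F} (hc : c ≠ 0) : Ed (c • f) = Ed f := by
  apply le_antisymm
  · rintro _ ⟨u, h, rfl⟩
    have h' : f ⬝ᵥ u = 0 := by
      rw [smul_dotProduct] at h
      exact (smul_eq_zero.1 h).resolve_left hc
    refine ⟨c • u, by rw [dotProduct_smul, h', smul_zero], ?_⟩
    congr 1
    apply tv_congr
    ext i j
    simp only [vecMulVec_apply, Pi.smul_apply, smul_eq_mul]
    ring
  · rintro _ ⟨u, h, rfl⟩
    refine ⟨c⁻¹ • u, by rw [smul_dotProduct, dotProduct_smul, h, smul_zero, smul_zero], ?_⟩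
    congr 1
    apply tv_congr
    ext i j
    simp only [vecMulVec_apply, Pi.smul_apply, smul_eq_mul]
    field_simp

lemma Par.E_eq {u w : Fin n → F} (h : Par u w) : E u = E w := by
  obtain ⟨c, hc, rfl⟩ := h
  exact (E_smul u hc).symm

lemma Par.Ed_eq {u w : Fin n → F} (h : Par u w) : Ed u = Ed w := by
  obtain ⟨c, hc, rfl⟩ := h
  exact (Ed_smul u hc).symm

lemma isT_of_mem_E {u : Fin n → F} (hu : u ≠ 0) {x : PS n F} (hx : x ∈ E u) (h1 : x ≠ 1) :
    IsT x := by
  obtain ⟨f, h, rfl⟩ := hx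
  refine ⟨u, f, h, hu, ?_, rfl⟩
  rintro rfl
  exact h1 (by rw [tv_zero_right, map_one])

lemma isT_of_mem_Ed {f : Fin n → F} (hf : f ≠ 0) {x : PS n F} (hx : x ∈ Ed f) (h1 : x ≠ 1) :
    IsT x := by
  obtain ⟨u, h, rfl⟩ := hx
  refine ⟨u, f, h, ?_, hf, rfl⟩
  rintro rfl
  exact h1 (by rw [tv_zero_left, map_one])

/-- a transvection lying in `E u` has centre `u`. -/
lemma tv_mem_E (hn : 3 ≤ n) {u u' f : Fin n → F} {h : f ⬝ᵥ u = 0} (hu : u ≠ 0) (hf : f ≠ 0) :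
    pr (tv u f h) ∈ E u' ↔ Par u u' := by
  constructor
  · rintro ⟨f', h', e⟩
    exact (vm_par hu hf (pr_tv_inj hn e)).1
  · intro hp
    rw [← hp.E_eq]
    exact ⟨f, h, rfl⟩

lemma tv_mem_Ed (hn : 3 ≤ n) {u f f' : Fin n → F} {h : f ⬝ᵥ u = 0} (hu : u ≠ 0) (hf : f ≠ 0) :
    pr (tv u f h) ∈ Ed f' ↔ Par f f' := by
  constructor
  · rintro ⟨f', h', e⟩
    exact (vm_par hu hf (pr_tv_inj hn e)).2
  · intro hp
    rw [← hp.Ed_eq]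
    exact ⟨u, h, rfl⟩

lemma E_le_E (hn : 3 ≤ n) {u u' : Fin n → F} (hu : u ≠ 0) (h : E u ≤ E u') : Par u u' := by
  obtain ⟨f, hf, hfu, _⟩ := exists_ann' hn u u
  exact (tv_mem_E hn hu hf).1 (h ⟨f, hfu, rfl⟩)

lemma Ed_le_Ed (hn : 3 ≤ n) {f f' : Fin n → F} (hf : f ≠ 0) (h : Ed f ≤ Ed f') : Par f f' := by
  obtain ⟨u, hu, hfu, _⟩ := exists_ann hn f f
  exact (tv_mem_Ed hn hu hf).1 (h ⟨u, hfu, rfl⟩)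

lemma not_E_le_Ed (hn : 3 ≤ n) {u f : Fin n → F} (hu : u ≠ 0) (hf : f ≠ 0) : ¬ E u ≤ Ed f := by
  intro h
  obtain ⟨g, hg, hgu, hp⟩ := exists_ann_not_par hn u f hf
  exact hp ((tv_mem_Ed hn hu hg).1 (h ⟨g, hgu, rfl⟩)).symm

lemma not_Ed_le_E (hn : 3 ≤ n) {u f : Fin n → F} (hu : u ≠ 0) (hf : f ≠ 0) : ¬ Ed f ≤ E u := by
  intro h
  obtain ⟨w, hw, hwu, hp⟩ := exists_ann_not_par hn f u hu
  rw [dotProduct_comm] at hwu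
  exact hp ((tv_mem_E hn hw hf).1 (h ⟨w, hwu, rfl⟩)).symm

/-- a subgroup consisting of transvections lies in some `E u` or `Ed f` -/
lemma le_E_or_Ed (hn : 3 ≤ n) (A : Subgroup (PS n F)) (hA : ∀ x ∈ A, x ≠ 1 → IsT x)
    (hne : A ≠ ⊥) : (∃ u, u ≠ 0 ∧ A ≤ E u) ∨ (∃ f, f ≠ 0 ∧ A ≤ Ed f) := by
  obtain ⟨⟨x, hx⟩, hx1⟩ := Subgroup.ne_bot_iff_exists_ne_one.1 hne
  have hx1 : x ≠ 1 := fun h => hx1 (Subtype.ext h)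
  obtain ⟨u, f, h, hu, hf, rfl⟩ := hA x hx hx1
  have key : ∀ u f h u' f' h', u ≠ 0 → f ≠ 0 → u' ≠ 0 → f' ≠ 0 →
      (pr (tv u f h) : PS n F) ∈ A → pr (tv u' f' h') ∈ A → Par u u' ∨ Par f f' := by
    intro u f h u' f' h' hu hf hu' hf' hm hm'
    by_cases h1 : (pr (tv u f h) : PS n F) * pr (tv u' f' h') = 1
    · have : (pr (tv u f h) : PS n F) ∈ E u' := by
        rw [eq_inv_of_mul_eq_one_left h1]
        exact (E u').inv_mem ⟨f', h', rfl⟩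
      exact Or.inl ((tv_mem_E hn hu hf).1 this)
    · obtain ⟨u'', f'', h'', _, _, e⟩ := hA _ (A.mul_mem hm hm') h1
      exact pr_tv_mul hn hu hf hu' hf' e
  by_cases hE : A ≤ E u
  · exact Or.inl ⟨u, hu, hE⟩
  by_cases hEd : A ≤ Ed f
  · exact Or.inr ⟨f, hf, hEd⟩
  exfalso
  obtain ⟨y, hy, hyE⟩ := SetLike.not_le_iff_exists.1 hE
  obtain ⟨z, hz, hzE⟩ := SetLike.not_le_iff_exists.1 hEd
  have hy1 : y ≠ 1 := fun h => hyE (h ▸ (E u).one_mem)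
  have hz1 : z ≠ 1 := fun h => hzE (h ▸ (Ed f).one_mem)
  obtain ⟨uy, fy, hy', huy, hfy, rfl⟩ := hA y hy hy1
  obtain ⟨uz, fz, hz', huz, hfz, rfl⟩ := hA z hz hz1
  rw [tv_mem_E hn huy hfy] at hyE
  rw [tv_mem_Ed hn huz hfz] at hzE
  have h1 := (key _ _ _ _ _ _ huy hfy hu hf hy hx).resolve_left hyE
  have h2 := (key _ _ _ _ _ _ huz hfz hu hf hz hx).resolve_right hzE
  rcases key _ _ _ _ _ _ huy hfy huz hfz hy hz with h3 | h3
  · exact hyE (h3.trans h2)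
  · exact hzE (h3.symm.trans h1)

lemma E_inf_Ed (hn : 3 ≤ n) {u f : Fin n → F} (hu : u ≠ 0) (hf : f ≠ 0) :
    E u ⊓ Ed f ≠ ⊥ ↔ f ⬝ᵥ u = 0 := by
  constructor
  · intro h
    obtain ⟨x, hxx⟩ := Subgroup.ne_bot_iff_exists_ne_one.1 h
    obtain ⟨x, hx, hx'⟩ := x
    have hx1 : x ≠ 1 := fun h => hxx (Subtype.ext h)
    clear hxx
    obtain ⟨g, hg, rfl⟩ := hx
    have hg0 : g ≠ 0 := by
      rintro rfl
      exact hx1 (by rw [tv_zero_right, map_one])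
    obtain ⟨c, hc, rfl⟩ := (tv_mem_Ed hn hu hg0).1 hx'
    rw [smul_dotProduct, hg, smul_zero]
  · intro h h'
    have : pr (tv u f h) ∈ (⊥ : Subgroup (PS n F)) := by
      rw [← h']
      exact ⟨⟨f, h, rfl⟩, ⟨u, h, rfl⟩⟩
    exact pr_tv_ne_one hn hu hf (Subgroup.mem_bot.1 this)

lemma E_inf_E (hn : 3 ≤ n) {u w : Fin n → F} (hu : u ≠ 0) (h : E u ⊓ E w ≠ ⊥) : E u = E w := by
  obtain ⟨x, hxx⟩ := Subgroup.ne_bot_iff_exists_ne_one.1 h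
  obtain ⟨x, hx, hx'⟩ := x
  have hx1 : x ≠ 1 := fun h => hxx (Subtype.ext h)
  clear hxx
  obtain ⟨g, hg, rfl⟩ := hx
  have hg0 : g ≠ 0 := by
    rintro rfl
    exact hx1 (by rw [tv_zero_right, map_one])
  exact ((tv_mem_E hn hu hg0).1 hx').E_eq

lemma Ed_inf_Ed (hn : 3 ≤ n) {f g : Fin n → F} (hf : f ≠ 0) (h : Ed f ⊓ Ed g ≠ ⊥) :
    Ed f = Ed g := by
  obtain ⟨x, hxx⟩ := Subgroup.ne_bot_iff_exists_ne_one.1 h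
  obtain ⟨x, hx, hx'⟩ := x
  have hx1 : x ≠ 1 := fun h => hxx (Subtype.ext h)
  clear hxx
  obtain ⟨u, hg, rfl⟩ := hx
  have hg0 : u ≠ 0 := by
    rintro rfl
    exact hx1 (by rw [tv_zero_left, map_one])
  exact ((tv_mem_Ed hn hg0 hf).1 hx').Ed_eq

lemma E_ne_bot (hn : 3 ≤ n) {u : Fin n → F} (hu : u ≠ 0) : E u ≠ ⊥ := by
  obtain ⟨f, hf, hfu, _⟩ := exists_ann' hn u u
  intro h
  have : pr (tv u f hfu) ∈ (⊥ : Subgroup (PS n F)) := h ▸ ⟨f, hfu, rfl⟩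
  exact pr_tv_ne_one hn hu hf (Subgroup.mem_bot.1 this)

lemma Ed_ne_bot (hn : 3 ≤ n) {f : Fin n → F} (hf : f ≠ 0) : Ed f ≠ ⊥ := by
  obtain ⟨u, hu, hfu, _⟩ := exists_ann hn f f
  intro h
  have : pr (tv u f hfu) ∈ (⊥ : Subgroup (PS n F)) := h ▸ ⟨u, hfu, rfl⟩
  exact pr_tv_ne_one hn hu hf (Subgroup.mem_bot.1 this)

/-- self-centralizing property, for the first basis vector -/
lemma mem_E_of_commute (hn : 3 ≤ n) (i : Fin n) (x : PS n F)
    (hx : ∀ y ∈ E (Pi.single i 1 : Fin n → F), x * y = y * x) :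
    x ∈ E (Pi.single i 1 : Fin n → F) := by
  obtain ⟨A, rfl⟩ := pr_surj x
  set u : Fin n → F := Pi.single i 1 with hu_def
  have hu : u ≠ 0 := by
    intro h
    have := congrFun h i
    simp [u] at this
  have h1 : ∀ f : Fin n → F, f ⬝ᵥ u = 0 →
      vecMulVec ((A : Matrix (Fin n) (Fin n) F) *ᵥ u) f =
        vecMulVec u (f ᵥ* (A : Matrix (Fin n) (Fin n) F)) := by
    intro f hf
    have e := hx (pr (tv u f hf)) ⟨f, hf, rfl⟩
    rw [← mul_inv_eq_iff_eq_mul, ← map_mul, ← map_inv, ← map_mul, tv_conj] at e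
    have e2 := congrArg (· * (A : Matrix (Fin n) (Fin n) F)) (pr_tv_inj hn e)
    simpa only [vecMulVec_mul, vecMul_vecMul, ← Matrix.SpecialLinearGroup.coe_mul, inv_mul_cancel,
      Matrix.SpecialLinearGroup.coe_one, vecMul_one] using e2
  have entry : ∀ j, j ≠ i → ∀ k l, A k i * (Pi.single j 1 : Fin n → F) l = u k * A j l := by
    intro j hj k l
    have hf : (Pi.single j 1 : Fin n → F) ⬝ᵥ u = 0 := by simp [u, hj]
    have := congrFun (congrFun (h1 _ hf) k) l
    simpa [vecMulVec_apply, u] using this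
  obtain ⟨j0, hj0⟩ : ∃ j : Fin n, j ≠ i := by
    have : Nontrivial (Fin n) := Fin.nontrivial_iff_two_le.2 (by omega)
    exact exists_ne i
  set a : F := A i i with ha
  -- column i
  have hcol : ∀ k, k ≠ i → A k i = 0 := by
    intro k hk
    have := entry j0 hj0 k j0
    simpa [u, hk] using this
  -- row j
  have hrow : ∀ j, j ≠ i → ∀ l, A j l = a * (Pi.single j 1 : Fin n → F) l := by
    intro j hj l
    have := entry j hj i l
    simpa [u, ha] using this.symm
  have ha0 : a ≠ 0 := by
    intro h0
    have hz : (A : Matrix (Fin n) (Fin n) F) *ᵥ u = 0 := by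
      funext k
      simp only [u, mulVec_single_one, col_apply, Pi.zero_apply]
      by_cases hk : k = i
      · rw [hk]; exact h0
      · exact hcol k hk
    exact mulVec_ne_zero_sl A hu hz
  let w : Fin n → F := fun l => if l = i then 0 else a⁻¹ * A i l
  have hw : w ⬝ᵥ u = 0 := by simp [w, u]
  refine ⟨w, hw, ?_⟩
  symm
  rw [pr_eq_iff]
  refine ⟨a, ?_⟩
  rw [tv_coe]
  ext k l
  simp only [Matrix.smul_apply, Matrix.add_apply, vecMulVec_apply, smul_eq_mul, u, w, one_apply]
  by_cases hk : k = i
  · subst hk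
    by_cases hl : l = k
    · subst hl; simp [ha]
    · simp [hl, Ne.symm hl, ha0]
  · rw [hrow k hk]
    simp [hk, Pi.single_apply, eq_comm]

end Roots

section Auts

variable {n : ℕ} {F : Type*} [Field F]

lemma pr_tv_pow {u f : Fin n → F} (h : f ⬝ᵥ u = 0) (k : ℕ) :
    (pr (tv u f h)) ^ k = pr (tv u ((k : F) • f) (by rw [smul_dotProduct, h, smul_zero])) := by
  induction k with
  | zero =>
    rw [pow_zero, ← map_one pr, ← tv_zero_right u]
    congr 1
    exact tv_congr _ _ (by simp)
  | succ k ih =>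
    rw [pow_succ, ih, ← map_mul, tv_mul_left]
    congr 1
    apply tv_congr
    congr 1
    push_cast
    rw [add_smul, one_smul]

lemma E_isPGroup (p : ℕ) [Fact p.Prime] [CharP F p] (u : Fin n → F) : IsPGroup p (E u) := by
  rintro ⟨x, f, h, rfl⟩
  refine ⟨1, Subtype.ext ?_⟩
  simp only [pow_one, Subgroup.coe_pow, Subgroup.coe_one]
  rw [pr_tv_pow, ← map_one pr, ← tv_zero_right u]
  congr 1
  exact tv_congr _ _ (by simp)

variable [Finite F]

lemma isT_iff (hn : 3 ≤ n) (p : ℕ) [Fact p.Prime] [CharP F p] (x : PS n F) :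
    IsT x ↔ x ≠ 1 ∧ ∃ S : Sylow p (PS n F), x ∈ (S : Subgroup (PS n F)) ∧
      ∀ y ∈ (S : Subgroup (PS n F)), x * y = y * x := by
  let i : Fin n := ⟨0, by omega⟩
  have hu : (Pi.single i 1 : Fin n → F) ≠ 0 := by
    intro h
    have := congrFun h i
    simp at this
  obtain ⟨S0, hS0⟩ := (E_isPGroup p (Pi.single i 1 : Fin n → F)).exists_le_sylow
  have hz : ∃ z ∈ (S0 : Subgroup (PS n F)), z ≠ 1 ∧ ∀ y ∈ (S0 : Subgroup (PS n F)),
      z * y = y * z := by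
    haveI : Nontrivial (S0 : Subgroup (PS n F)) := by
      rw [Subgroup.nontrivial_iff_ne_bot]
      intro hb
      exact E_ne_bot hn hu (le_bot_iff.1 (hb ▸ hS0))
    haveI := S0.isPGroup'.center_nontrivial
    obtain ⟨⟨z, hz⟩, hz1⟩ := exists_ne (1 : Subgroup.center (S0 : Subgroup (PS n F)))
    refine ⟨z, z.2, fun h => hz1 (Subtype.ext (Subtype.ext h)), fun y hy => ?_⟩
    have := Subgroup.mem_center_iff.1 hz ⟨y, hy⟩
    exact (congrArg Subtype.val this).symm
  have hT : ∀ z ∈ (S0 : Subgroup (PS n F)), z ≠ 1 →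
      (∀ y ∈ (S0 : Subgroup (PS n F)), z * y = y * z) → IsT z := by
    intro z _ hz1 hc
    exact isT_of_mem_E hu (mem_E_of_commute hn i z fun y hy => hc y (hS0 hy)) hz1
  constructor
  · intro hx
    refine ⟨hx.ne_one hn, ?_⟩
    obtain ⟨z, hz, hz1, hc⟩ := hz
    obtain ⟨g, rfl⟩ := isConj_iff.1 ((hT z hz hz1 hc).isConj hn hx)
    refine ⟨g • S0, ?_, ?_⟩
    · rw [Sylow.coe_subgroup_smul, Subgroup.mem_pointwise_smul_iff_inv_smul_mem]
      simpa [← map_inv, mul_assoc] using hz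
    · intro y hy
      rw [Sylow.coe_subgroup_smul, Subgroup.mem_pointwise_smul_iff_inv_smul_mem] at hy
      have := hc _ hy
      simp only [← map_inv, MulAut.smul_def, MulAut.conj_apply, inv_inv] at this
      calc g * z * g⁻¹ * y = g * (z * (g⁻¹ * y * g)) * g⁻¹ := by group
        _ = _ := by rw [this]; group
  · rintro ⟨hx1, S, hx, hc⟩
    obtain ⟨g, rfl⟩ := MulAction.exists_smul_eq (PS n F) S0 S
    rw [Sylow.coe_subgroup_smul, Subgroup.mem_pointwise_smul_iff_inv_smul_mem] at hx
    have : IsT (g⁻¹ * x * g) := by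
      apply hT
      · simpa [← map_inv] using hx
      · intro h
        apply hx1
        calc x = g * (g⁻¹ * x * g) * g⁻¹ := by group
          _ = 1 := by rw [h]; group
      · intro y hy
        have h2 := hc (g * y * g⁻¹) (by
          rw [Sylow.coe_subgroup_smul, Subgroup.mem_pointwise_smul_iff_inv_smul_mem]
          simpa [← map_inv, mul_assoc] using hy)
        calc g⁻¹ * x * g * y = g⁻¹ * (x * (g * y * g⁻¹)) * g := by group
          _ = _ := by rw [h2]; group
    have h3 := this.conj g
    have e : g * (g⁻¹ * x * g) * g⁻¹ = x := by group
    rwa [e] at h3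

lemma IsT.aut (hn : 3 ≤ n) (p : ℕ) [Fact p.Prime] [CharP F p] {x : PS n F} (hx : IsT x)
    (φ : MulAut (PS n F)) : IsT (φ x) := by
  rw [isT_iff hn p] at hx ⊢
  obtain ⟨h1, S, hS, hc⟩ := hx
  refine ⟨fun h => h1 (by simpa using h), φ • S, ?_, ?_⟩
  · exact Subgroup.smul_mem_pointwise_smul x φ _ hS
  · intro y hy
    have hy : y ∈ φ • (S : Subgroup (PS n F)) := hy
    rw [Subgroup.mem_pointwise_smul_iff_inv_smul_mem] at hy
    have := congrArg φ (hc _ hy)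
    simpa using this

/-- point type subgroups -/
def IsPt (K : Subgroup (PS n F)) : Prop := ∃ u : Fin n → F, u ≠ 0 ∧ K = E u
/-- hyperplane type subgroups -/
def IsHy (K : Subgroup (PS n F)) : Prop := ∃ f : Fin n → F, f ≠ 0 ∧ K = Ed f

lemma IsPt.not_hy (hn : 3 ≤ n) {K : Subgroup (PS n F)} (h : IsPt K) (h' : IsHy K) : False := by
  obtain ⟨u, hu, rfl⟩ := h
  obtain ⟨f, hf, e⟩ := h'
  exact not_E_le_Ed hn hu hf e.le

lemma smul_type (hn : 3 ≤ n) (p : ℕ) [Fact p.Prime] [CharP F p] (φ : MulAut (PS n F))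
    {K : Subgroup (PS n F)} (hK : IsPt K ∨ IsHy K) : IsPt (φ • K) ∨ IsHy (φ • K) := by
  have gen : ∀ (φ : MulAut (PS n F)) (K : Subgroup (PS n F)), (IsPt K ∨ IsHy K) →
      ∃ L, (IsPt L ∨ IsHy L) ∧ φ • K ≤ L := by
    intro φ K hK
    have hKT : ∀ x ∈ K, x ≠ 1 → IsT x := by
      rcases hK with ⟨u, hu, rfl⟩ | ⟨f, hf, rfl⟩
      · exact fun x hx h1 => isT_of_mem_E hu hx h1
      · exact fun x hx h1 => isT_of_mem_Ed hf hx h1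
    have hKb : K ≠ ⊥ := by
      rcases hK with ⟨u, hu, rfl⟩ | ⟨f, hf, rfl⟩
      · exact E_ne_bot hn hu
      · exact Ed_ne_bot hn hf
    have := le_E_or_Ed hn (φ • K) (by
      intro x hx h1
      rw [Subgroup.mem_pointwise_smul_iff_inv_smul_mem] at hx
      have h2 := (hKT _ hx (fun h => h1 (by simpa using h))).aut hn p φ
      simpa using h2) (by
      intro h
      apply hKb
      rw [← inv_smul_smul φ K, h, Subgroup.smul_bot])
    rcases this with ⟨u, hu, h⟩ | ⟨f, hf, h⟩
    · exact ⟨_, Or.inl ⟨u, hu, rfl⟩, h⟩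
    · exact ⟨_, Or.inr ⟨f, hf, rfl⟩, h⟩
  have anti : ∀ K L : Subgroup (PS n F), (IsPt K ∨ IsHy K) → (IsPt L ∨ IsHy L) → K ≤ L → K = L := by
    rintro K L (⟨u, hu, rfl⟩ | ⟨f, hf, rfl⟩) (⟨w, hw, rfl⟩ | ⟨g, hg, rfl⟩) h
    · exact (E_le_E hn hu h).E_eq
    · exact (not_E_le_Ed hn hu hg h).elim
    · exact (not_Ed_le_E hn hw hf h).elim
    · exact (Ed_le_Ed hn hf h).Ed_eq
  obtain ⟨L, hL, hle⟩ := gen φ K hK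
  obtain ⟨M, hM, hle'⟩ := gen φ⁻¹ L hL
  have h1 : K ≤ φ⁻¹ • L := by
    rwa [← Subgroup.pointwise_smul_le_pointwise_smul_iff (a := φ), smul_inv_smul]
  have h2 := anti K M hK hM (h1.trans hle')
  have h3 : φ • K = L := by
    apply le_antisymm hle
    rw [← h2] at hle'
    rwa [← Subgroup.pointwise_smul_le_pointwise_smul_iff (a := φ), smul_inv_smul] at hle'
  rw [h3]; exact hL

lemma smul_inf_ne_bot (φ : MulAut (PS n F)) {K L : Subgroup (PS n F)} (h : K ⊓ L ≠ ⊥) :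
    φ • K ⊓ φ • L ≠ ⊥ := by
  intro h'
  rw [← Subgroup.smul_inf] at h'
  apply h
  rw [← inv_smul_smul φ (K ⊓ L), h', Subgroup.smul_bot]

/-- incident elements of opposite type remain of opposite type -/
lemma smul_opp (hn : 3 ≤ n) (p : ℕ) [Fact p.Prime] [CharP F p] (φ : MulAut (PS n F))
    {K L : Subgroup (PS n F)} (hK : IsPt K) (hL : IsHy L) (h : K ⊓ L ≠ ⊥) :
    (IsPt (φ • K) ∧ IsHy (φ • L)) ∨ (IsHy (φ • K) ∧ IsPt (φ • L)) := by
  have hne : φ • K ≠ φ • L := by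
    intro e
    rw [smul_left_cancel_iff] at e
    exact hK.not_hy hn (e ▸ hL)
  have hm := smul_inf_ne_bot φ h
  rcases smul_type hn p φ (Or.inl hK) with h1 | h1 <;>
    rcases smul_type hn p φ (Or.inr hL) with h2 | h2
  · obtain ⟨u, hu, e1⟩ := h1
    obtain ⟨w, hw, e2⟩ := h2
    rw [e1, e2] at hm hne
    exact (hne (E_inf_E hn hu hm)).elim
  · exact Or.inl ⟨h1, h2⟩
  · exact Or.inr ⟨h1, h2⟩
  · obtain ⟨u, hu, e1⟩ := h1
    obtain ⟨w, hw, e2⟩ := h2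
    rw [e1, e2] at hm hne
    exact (hne (Ed_inf_Ed hn hu hm)).elim

/-- type preserving automorphisms -/
def TP (φ : MulAut (PS n F)) : Prop :=
  (∀ K : Subgroup (PS n F), IsPt K → IsPt (φ • K)) ∧
    ∀ K : Subgroup (PS n F), IsHy K → IsHy (φ • K)

/-- type swapping automorphisms -/
def TS (φ : MulAut (PS n F)) : Prop :=
  (∀ K : Subgroup (PS n F), IsPt K → IsHy (φ • K)) ∧
    ∀ K : Subgroup (PS n F), IsHy K → IsPt (φ • K)

lemma tp_or_ts (hn : 3 ≤ n) (p : ℕ) [Fact p.Prime] [CharP F p] (φ : MulAut (PS n F)) :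
    TP φ ∨ TS φ := by
  have hyp : ∀ L : Subgroup (PS n F), IsHy L → ∃ K, IsPt K ∧ K ⊓ L ≠ ⊥ := by
    rintro _ ⟨f, hf, rfl⟩
    obtain ⟨u, hu, hfu, _⟩ := exists_ann hn f f
    exact ⟨E u, ⟨u, hu, rfl⟩, (E_inf_Ed hn hu hf).2 hfu⟩
  have conn : ∀ K K' : Subgroup (PS n F), IsPt K → IsPt K' →
      ∃ L, IsHy L ∧ K ⊓ L ≠ ⊥ ∧ K' ⊓ L ≠ ⊥ := by
    rintro _ _ ⟨u, hu, rfl⟩ ⟨w, hw, rfl⟩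
    obtain ⟨f, hf, h1, h2⟩ := exists_ann' hn u w
    exact ⟨Ed f, ⟨f, hf, rfl⟩, (E_inf_Ed hn hu hf).2 h1, (E_inf_Ed hn hw hf).2 h2⟩
  by_cases h : ∃ K : Subgroup (PS n F), IsPt K ∧ IsPt (φ • K)
  · left
    obtain ⟨K0, hK0, hK0'⟩ := h
    have hp : ∀ K : Subgroup (PS n F), IsPt K → IsPt (φ • K) := by
      intro K hK
      obtain ⟨L, hL, h1, h2⟩ := conn K0 K hK0 hK
      rcases smul_opp hn p φ hK0 hL h1 with ⟨_, h3⟩ | ⟨h3, _⟩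
      · rcases smul_opp hn p φ hK hL h2 with ⟨h4, _⟩ | ⟨_, h4⟩
        · exact h4
        · exact (h4.not_hy hn h3).elim
      · exact (hK0'.not_hy hn h3).elim
    refine ⟨hp, fun L hL => ?_⟩
    obtain ⟨K, hK, hm⟩ := hyp L hL
    rcases smul_opp hn p φ hK hL hm with ⟨_, h4⟩ | ⟨h4, _⟩
    · exact h4
    · exact ((hp K hK).not_hy hn h4).elim
  · right
    have hp : ∀ K : Subgroup (PS n F), IsPt K → IsHy (φ • K) := by
      intro K hK
      rcases smul_type hn p φ (Or.inl hK) with h1 | h1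
      · exact (h ⟨K, hK, h1⟩).elim
      · exact h1
    refine ⟨hp, fun L hL => ?_⟩
    obtain ⟨K, hK, hm⟩ := hyp L hL
    rcases smul_opp hn p φ hK hL hm with ⟨h4, _⟩ | ⟨_, h4⟩
    · exact (h4.not_hy hn (hp K hK)).elim
    · exact h4

lemma tp_sq (hn : 3 ≤ n) (p : ℕ) [Fact p.Prime] [CharP F p] (φ : MulAut (PS n F)) :
    TP (φ * φ) := by
  rcases tp_or_ts hn p φ with h | h
  · exact ⟨fun K hK => by rw [mul_smul]; exact h.1 _ (h.1 _ hK),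
      fun K hK => by rw [mul_smul]; exact h.2 _ (h.2 _ hK)⟩
  · exact ⟨fun K hK => by rw [mul_smul]; exact h.2 _ (h.1 _ hK),
      fun K hK => by rw [mul_smul]; exact h.1 _ (h.2 _ hK)⟩

end Auts

section Main

lemma card_fix_modEq {Γ Ω : Type*} [Group Γ] [MulAction Γ Ω] [DecidableEq Ω] (ψ : Γ) (r : ℕ)
    (hr : r.Prime) (hψ : ψ ^ r = 1) (s : Finset Ω) (hs : ∀ K ∈ s, ψ • K ∈ s) :
    s.card ≡ (s.filter fun K => ψ • K = K).card [MOD r] := by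
  have := Fact.mk hr
  let f : Function.End s := fun K => ⟨ψ • (K : Ω), hs K K.2⟩
  have hf : ∀ (k : ℕ) (K : s), (((f ^ k) K : s) : Ω) = ψ ^ k • (K : Ω) := by
    intro k
    induction k with
    | zero => intro K; rw [pow_zero, pow_zero, one_smul]; rfl
    | succ k ih =>
      intro K
      rw [pow_succ, pow_succ, mul_smul]
      exact ih (f K)
  have h1 : f ^ r ^ 1 = 1 := by
    funext K
    apply Subtype.ext
    rw [hf, pow_one, hψ, one_smul]
    rfl
  have h2 := Equiv.Perm.card_fixedPoints_modEq h1
  rw [Fintype.card_coe] at h2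
  have h3 : Fintype.card f.fixedPoints = (s.filter fun K => ψ • K = K).card := ?_
  · rwa [h3] at h2
  rw [← Fintype.card_coe]
  refine Fintype.card_congr ⟨fun K => ⟨K.1.1, Finset.mem_filter.2 ⟨K.1.2, ?_⟩⟩,
    fun K => ⟨⟨K.1, (Finset.mem_filter.1 K.2).1⟩, ?_⟩, fun _ => rfl, fun _ => rfl⟩
  · exact congrArg Subtype.val K.2
  · exact Subtype.ext (Finset.mem_filter.1 K.2).2

variable {n : ℕ} {F : Type*} [Field F]

lemma E_zero : E (0 : Fin n → F) = ⊥ := by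
  rw [eq_bot_iff]
  rintro _ ⟨f, h, rfl⟩
  rw [Subgroup.mem_bot, tv_zero_left, map_one]

lemma conj_E (g : Matrix.SpecialLinearGroup (Fin n) F) (u : Fin n → F) :
    MulAut.conj (pr g) • E u = E ((g : Matrix (Fin n) (Fin n) F) *ᵥ u) := by
  have key : ∀ (g : Matrix.SpecialLinearGroup (Fin n) F) (u : Fin n → F),
      MulAut.conj (pr g) • E u ≤ E ((g : Matrix (Fin n) (Fin n) F) *ᵥ u) := by
    intro g u x hx
    rw [Subgroup.mem_pointwise_smul_iff_inv_smul_mem] at hx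
    obtain ⟨f, h, e⟩ := hx
    rw [inv_smul_eq_iff, MulAut.smul_def, MulAut.conj_apply, ← map_mul, ← map_inv, ← map_mul,
      tv_conj] at e
    exact ⟨_, _, e⟩
  apply le_antisymm (key g u)
  have := key g⁻¹ ((g : Matrix (Fin n) (Fin n) F) *ᵥ u)
  rw [mulVec_mulVec, ← Matrix.SpecialLinearGroup.coe_mul, inv_mul_cancel,
    Matrix.SpecialLinearGroup.coe_one, one_mulVec, map_inv, map_inv] at this
  rwa [← Subgroup.pointwise_smul_le_pointwise_smul_iff (a := MulAut.conj (pr g)),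
    smul_inv_smul] at this

lemma eq_one_of_fix (hn : 3 ≤ n) (ψ : MulAut (PS n F))
    (h : ∀ u : Fin n → F, ψ • E u = E u) : ψ = 1 := by
  ext y
  obtain ⟨A, rfl⟩ := pr_surj y
  obtain ⟨B, hB⟩ := pr_surj (ψ (pr A))
  rw [MulAut.one_apply, ← hB]
  have h1 : ∀ u : Fin n → F, u ≠ 0 → Par ((A : Matrix (Fin n) (Fin n) F) *ᵥ u)
      ((B : Matrix (Fin n) (Fin n) F) *ᵥ u) := by
    intro u hu
    apply E_le_E hn (mulVec_ne_zero_sl A hu)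
    rw [← conj_E, ← conj_E, hB]
    have e : MulAut.conj (ψ (pr A)) = ψ * MulAut.conj (pr A) * ψ⁻¹ := by
      ext x
      simp
    have e2 : ψ⁻¹ • E u = E u := by rw [inv_smul_eq_iff, h]
    rw [e, mul_smul, mul_smul, e2, conj_E, h]
  set C := A⁻¹ * B with hC
  have h2 : ∀ u : Fin n → F, ∃ c : F, (C : Matrix (Fin n) (Fin n) F) *ᵥ u = c • u := by
    intro u
    by_cases hu : u = 0
    · exact ⟨0, by simp [hu]⟩
    obtain ⟨c, _, hc⟩ := h1 u hu
    refine ⟨c, ?_⟩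
    rw [hC, Matrix.SpecialLinearGroup.coe_mul, ← mulVec_mulVec, hc, mulVec_smul, mulVec_mulVec,
      ← Matrix.SpecialLinearGroup.coe_mul, inv_mul_cancel, Matrix.SpecialLinearGroup.coe_one,
      one_mulVec]
  obtain ⟨a, ha⟩ := LinearMap.exists_eq_smul_id_of_forall_notLinearIndependent
    (f := Matrix.toLin' (C : Matrix (Fin n) (Fin n) F)) (by
      intro v hv
      obtain ⟨c, hc⟩ := h2 v
      rw [LinearIndependent.pair_iff] at hv
      have := (hv c (-1) (by rw [toLin'_apply, hc]; simp)).2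
      simp at this)
  symm
  rw [pr_eq_iff]
  refine ⟨a, ?_⟩
  have hCa : (C : Matrix (Fin n) (Fin n) F) = a • 1 := by
    have := congrArg LinearMap.toMatrix' ha
    rw [LinearMap.toMatrix'_toLin'] at this
    rw [this]
    simp
  have : B = A * C := by rw [hC]; group
  rw [this, Matrix.SpecialLinearGroup.coe_mul, hCa]
  simp

variable [Fintype F]

lemma unit_eq_one {r : ℕ} (hr : r.Prime) (hrq : Fintype.card F < r) {a : F} (ha : a ^ r = 1) :
    a = 1 := by
  have ha0 : a ≠ 0 := by
    rintro rfl
    rw [zero_pow hr.ne_zero] at ha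
    exact zero_ne_one ha
  have h1 := orderOf_dvd_of_pow_eq_one ha
  have h2 := orderOf_dvd_of_pow_eq_one (FiniteField.pow_card_sub_one_eq_one a ha0)
  rcases (Nat.dvd_prime hr).1 h1 with h | h
  · exact orderOf_eq_one_iff.1 h
  · rw [h] at h2
    have h3 : 1 < Fintype.card F := Fintype.one_lt_card
    have := Nat.le_of_dvd (by omega) h2
    omega

/-- prime divisors of `|GL|` larger than `q` divide `|PSL|` -/
lemma dvd_card_PS {r : ℕ} (hr : r.Prime) (hrq : Fintype.card F < r)
    {w : ℕ} (hw : w < n) (h : r ∣ Fintype.card F ^ n - Fintype.card F ^ w) :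
    r ∣ Nat.card (PS n F) := by
  classical
  have := Fact.mk hr
  have h1 : r ∣ Nat.card (GL (Fin n) F) := by
    rw [Matrix.card_GL_field]
    exact h.trans (Finset.dvd_prod_of_mem (fun i : Fin n =>
      Fintype.card F ^ n - Fintype.card F ^ (i : ℕ)) (Finset.mem_univ ⟨w, hw⟩))
  obtain ⟨g, hg⟩ := exists_prime_orderOf_dvd_card' r h1
  have hgr : g ^ r = 1 := by rw [← hg, pow_orderOf_eq_one]
  have hgr' : (g : Matrix (Fin n) (Fin n) F) ^ r = 1 := by
    rw [← Units.val_pow_eq_pow_val, hgr, Units.val_one]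
  have hdet : (g : Matrix (Fin n) (Fin n) F).det = 1 := by
    apply unit_eq_one hr hrq
    rw [← det_pow, hgr', det_one]
  let A : Matrix.SpecialLinearGroup (Fin n) F := ⟨g, hdet⟩
  have hA : A ^ r = 1 := by
    apply sl_ext
    rw [Matrix.SpecialLinearGroup.coe_pow, Matrix.SpecialLinearGroup.coe_one]
    exact hgr'
  have hord : orderOf (pr A) = r := by
    apply orderOf_eq_prime
    · rw [← map_pow, hA, map_one]
    · intro h1
      rw [← map_one pr, eq_comm, pr_eq_iff] at h1
      obtain ⟨a, ha⟩ := h1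
      rw [Matrix.SpecialLinearGroup.coe_one] at ha
      have ha' : (g : Matrix (Fin n) (Fin n) F) = a • 1 := ha
      have h3 := hgr'
      rw [ha', smul_pow, one_pow] at h3
      have h4 := congrFun (congrFun h3 ⟨w, hw⟩) ⟨w, hw⟩
      simp only [Matrix.smul_apply, one_apply_eq, smul_eq_mul, mul_one] at h4
      rw [unit_eq_one hr hrq h4, one_smul] at ha'
      have : g = 1 := Units.ext ha'
      rw [this, orderOf_one] at hg
      exact hr.ne_one hg.symm
  rw [← hord]
  exact orderOf_dvd_natCard _

lemma TP.pow {ψ : MulAut (PS n F)} (h : TP ψ) (k : ℕ) : TP (ψ ^ k) := by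
  induction k with
  | zero => exact ⟨fun K hK => by simpa using hK, fun K hK => by simpa using hK⟩
  | succ k ih =>
    rw [pow_succ]
    exact ⟨fun K hK => by rw [mul_smul]; exact ih.1 _ (h.1 _ hK),
      fun K hK => by rw [mul_smul]; exact ih.2 _ (h.2 _ hK)⟩

lemma TP.inv {ψ : MulAut (PS n F)} (h : TP ψ) {r : ℕ} (hr : r.Prime) (hψ : ψ ^ r = 1) :
    TP ψ⁻¹ := by
  have : ψ⁻¹ = ψ ^ (r - 1) := by
    rw [inv_eq_iff_mul_eq_one, ← pow_succ', Nat.sub_add_cancel hr.pos, hψ]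
  rw [this]
  exact h.pow _

/-- images of points on a fixed line stay on the line -/
lemma smul_line (hn : 3 ≤ n) {ψ : MulAut (PS n F)} (h' : TP ψ⁻¹)
    {x y z w : Fin n → F} (hx0 : x ≠ 0) (hy0 : y ≠ 0) (hx : ψ • E x = E x) (hy : ψ • E y = E y)
    (hz : ∃ a b : F, z = a • x + b • y) (hz0 : z ≠ 0) (hw0 : w ≠ 0) (hw : ψ • E z = E w) :
    ∃ a b : F, w = a • x + b • y := by
  apply dbl_ann
  intro g hgx hgy
  by_cases hg : g = 0
  · simp [hg]
  obtain ⟨k, hk, e⟩ := h'.2 (Ed g) ⟨g, hg, rfl⟩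
  have hx' : ψ⁻¹ • E x = E x := by rw [inv_smul_eq_iff, hx]
  have hy' : ψ⁻¹ • E y = E y := by rw [inv_smul_eq_iff, hy]
  have kx : k ⬝ᵥ x = 0 := by
    rw [← E_inf_Ed hn hx0 hk, ← e, ← hx']
    exact smul_inf_ne_bot _ ((E_inf_Ed hn hx0 hg).2 hgx)
  have ky : k ⬝ᵥ y = 0 := by
    rw [← E_inf_Ed hn hy0 hk, ← e, ← hy']
    exact smul_inf_ne_bot _ ((E_inf_Ed hn hy0 hg).2 hgy)
  have kz : k ⬝ᵥ z = 0 := by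
    obtain ⟨a, b, rfl⟩ := hz
    rw [dotProduct_add, dotProduct_smul, dotProduct_smul, kx, ky, smul_zero, smul_zero, add_zero]
  have := smul_inf_ne_bot ψ ((E_inf_Ed hn hz0 hk).2 kz)
  rwa [hw, ← e, smul_inv_smul, E_inf_Ed hn hw0 hg] at this

lemma fix_add (hn : 3 ≤ n) {ψ : MulAut (PS n F)} (h : TP ψ) {r : ℕ} (hr : r.Prime)
    (hrq : Fintype.card F < r) (hψ : ψ ^ r = 1)
    {x y : Fin n → F} (hx : ψ • E x = E x) (hy : ψ • E y = E y) : ψ • E (x + y) = E (x + y) := by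
  classical
  have hsm : ∀ (z : Fin n → F) (c : F), ψ • E z = E z → ψ • E (c • z) = E (c • z) := by
    intro z c hz
    by_cases hc : c = 0
    · rw [hc, zero_smul, E_zero, Subgroup.smul_bot]
    · rw [E_smul z hc, hz]
  by_cases hx0 : x = 0
  · rwa [hx0, zero_add]
  by_cases hy0 : y = 0
  · rwa [hy0, add_zero]
  by_cases hp : ∃ c : F, y = c • x
  · obtain ⟨c, rfl⟩ := hp
    have : x + c • x = (1 + c) • x := by rw [add_smul, one_smul]
    rw [this]
    exact hsm _ _ hx
  have hind : ∀ a b : F, a • x + b • y = 0 → b = 0 := by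
    intro a b e
    by_contra hb
    apply hp
    refine ⟨-(b⁻¹ * a), ?_⟩
    have e2 : b • y = -(a • x) := (neg_eq_of_add_eq_zero_right e).symm
    calc y = b⁻¹ • (b • y) := by rw [smul_smul, inv_mul_cancel₀ hb, one_smul]
      _ = _ := by rw [e2, smul_neg, smul_smul, neg_smul]
  have hne : ∀ c : F, x + c • y ≠ 0 := by
    intro c e
    have h1 : c = 0 := hind 1 c (by rwa [one_smul])
    rw [h1, zero_smul, add_zero] at e
    exact hx0 e
  have h' := h.inv hr hψ
  let s : Finset (Subgroup (PS n F)) :=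
    (Finset.univ : Finset Fˣ).image fun c : Fˣ => E (x + (c : F) • y)
  have hs : ∀ K ∈ s, ψ • K ∈ s := by
    intro K hK
    obtain ⟨c, _, rfl⟩ := Finset.mem_image.1 hK
    obtain ⟨w, hw, e⟩ := h.1 (E (x + (c : F) • y)) ⟨_, hne c, rfl⟩
    obtain ⟨a, b, rfl⟩ := smul_line hn h' hx0 hy0 hx hy ⟨1, c, by rw [one_smul]⟩ (hne c) hw e
    have ha : a ≠ 0 := by
      rintro rfl
      have hb : b ≠ 0 := by
        rintro rfl
        simp at hw
      rw [zero_smul, zero_add, E_smul y hb, ← hy, smul_left_cancel_iff] at e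
      obtain ⟨d, hd, e2⟩ := E_le_E hn hy0 e.ge
      have : (-1 : F) • x + (d - c) • y = 0 := by
        rw [sub_smul, ← e2]; simp
      have h3 := hind _ _ this
      rw [sub_eq_zero] at h3
      rw [h3] at e2
      exact hx0 (by simpa using e2)
    have hb : b ≠ 0 := by
      rintro rfl
      rw [zero_smul, add_zero, E_smul x ha, ← hx, smul_left_cancel_iff] at e
      obtain ⟨d, hd, e2⟩ := E_le_E hn hx0 e.ge
      have : (1 - d) • x + (c : F) • y = 0 := by
        rw [sub_smul, ← e2]; simp
      exact c.ne_zero (hind _ _ this)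
    refine Finset.mem_image.2 ⟨Units.mk0 (a⁻¹ * b) (mul_ne_zero (inv_ne_zero ha) hb),
      Finset.mem_univ _, ?_⟩
    rw [e, Units.val_mk0, ← E_smul _ ha, smul_add, smul_smul, mul_inv_cancel_left₀ ha]
  have hcard := card_fix_modEq ψ r hr hψ s hs
  have hlt : s.card < r := by
    calc s.card ≤ (Finset.univ : Finset Fˣ).card := Finset.card_image_le
      _ ≤ Fintype.card F := by
        rw [Finset.card_univ]
        exact Fintype.card_le_of_injective _ Units.val_injective
      _ < r := hrq
  have hle : (s.filter fun K => ψ • K = K).card ≤ s.card := Finset.card_filter_le _ _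
  have heq := Nat.ModEq.eq_of_lt_of_lt hcard hlt (hle.trans_lt hlt)
  have hall := Finset.card_filter_eq_iff.1 heq.symm
  have := hall (E (x + y)) (Finset.mem_image.2 ⟨1, Finset.mem_univ _, by simp⟩)
  exact this

/-- the fixed subspace -/
def fixW (hn : 3 ≤ n) {ψ : MulAut (PS n F)} (h : TP ψ) {r : ℕ} (hr : r.Prime)
    (hrq : Fintype.card F < r) (hψ : ψ ^ r = 1) : Submodule F (Fin n → F) where
  carrier := {x | ψ • E x = E x}
  add_mem' := fun hx hy => fix_add hn h hr hrq hψ hx hy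
  zero_mem' := by
    change ψ • E 0 = E 0
    rw [E_zero, Subgroup.smul_bot]
  smul_mem' := by
    intro c x hx
    change ψ • E (c • x) = E (c • x)
    by_cases hc : c = 0
    · rw [hc, zero_smul, E_zero, Subgroup.smul_bot]
    · rw [E_smul x hc]; exact hx

lemma tp_eq_one (hn : 3 ≤ n) {ψ : MulAut (PS n F)} (h : TP ψ) {r : ℕ} (hr : r.Prime)
    (hrq : Fintype.card F < r) (hrX : ¬ r ∣ Nat.card (PS n F)) (hψ : ψ ^ r = 1) : ψ = 1 := by
  classical
  let W := fixW hn h hr hrq hψ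
  have hW : ∀ x, x ∈ W ↔ ψ • E x = E x := fun x => Iff.rfl
  by_cases hWt : W = ⊤
  · apply eq_one_of_fix hn
    intro u
    rw [← hW, hWt]
    trivial
  exfalso
  apply hrX
  have hlt : Module.finrank F W < n := by
    have := Submodule.finrank_lt hWt
    simpa using this
  apply dvd_card_PS hr hrq hlt
  have hcW : (Finset.univ.filter fun z : Fin n → F => z ∉ W).card =
      Fintype.card F ^ n - Fintype.card F ^ (Module.finrank F W) := by
    have h1 : Fintype.card W = Fintype.card F ^ (Module.finrank F W) := Module.card_eq_pow_finrank
    rw [← h1, Finset.filter_not, Finset.card_sdiff_of_subset (Finset.filter_subset _ _)]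
    congr 1
    · simp
    · rw [Fintype.card_subtype]
  rw [← hcW]
  set S := Finset.univ.filter fun z : Fin n → F => z ∉ W with hS
  have hS0 : ∀ z ∈ S, z ≠ 0 := by
    rintro z hz rfl
    exact (Finset.mem_filter.1 hz).2 W.zero_mem
  rw [Finset.card_eq_sum_card_image (fun z => E z) S]
  have hfib : ∀ K ∈ S.image (fun z => E z), (S.filter fun z => E z = K).card = Fintype.card Fˣ := by
    intro K hK
    obtain ⟨z, hz, rfl⟩ := Finset.mem_image.1 hK
    have hz0 := hS0 z hz
    have : (S.filter fun z' => E z' = E z) =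
        (Finset.univ : Finset Fˣ).image fun c : Fˣ => (c : F) • z := by
      ext w
      simp only [Finset.mem_filter, Finset.mem_image, Finset.mem_univ, true_and]
      constructor
      · rintro ⟨_, e⟩
        obtain ⟨c, hc, e2⟩ := E_le_E hn hz0 e.ge
        exact ⟨Units.mk0 c hc, e2.symm⟩
      · rintro ⟨c, rfl⟩
        refine ⟨?_, E_smul z c.ne_zero⟩
        rw [hS, Finset.mem_filter, hW, E_smul z c.ne_zero, ← hW]
        exact ⟨Finset.mem_univ _, (Finset.mem_filter.1 hz).2⟩
    rw [this, Finset.card_image_of_injective, Finset.card_univ]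
    intro c d e
    exact Units.ext (smul_left_injective F hz0 e)
  rw [Finset.sum_congr rfl hfib, Finset.sum_const, smul_eq_mul]
  apply Dvd.dvd.mul_right
  have hm := card_fix_modEq ψ r hr hψ (S.image (fun z => E z)) (by
    intro K hK
    obtain ⟨z, hz, rfl⟩ := Finset.mem_image.1 hK
    obtain ⟨w, hw, e⟩ := h.1 (E z) ⟨z, hS0 z hz, rfl⟩
    rw [e]
    refine Finset.mem_image.2 ⟨w, ?_, rfl⟩
    rw [hS, Finset.mem_filter]
    refine ⟨Finset.mem_univ _, fun hw' => (Finset.mem_filter.1 hz).2 ?_⟩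
    rw [hW, ← e, smul_left_cancel_iff] at hw'
    exact hw')
  have h0 : ((S.image (fun z => E z)).filter fun K => ψ • K = K) = ∅ := by
    rw [Finset.filter_eq_empty_iff]
    intro K hK e
    obtain ⟨z, hz, rfl⟩ := Finset.mem_image.1 hK
    exact (Finset.mem_filter.1 hz).2 e
  rw [h0, Finset.card_empty] at hm
  exact (Nat.modEq_zero_iff_dvd).1 hm

theorem aut_eq_one (hn : 3 ≤ n) (p : ℕ) [Fact p.Prime] [CharP F p] {φ : MulAut (PS n F)} {r : ℕ}
    (hr : r.Prime) (hrq : Fintype.card F < r) (hrX : ¬ r ∣ Nat.card (PS n F)) (hφ : φ ^ r = 1) :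
    φ = 1 := by
  have h1 : φ * φ = 1 := by
    apply tp_eq_one hn (tp_sq hn p φ) hr hrq hrX
    rw [← pow_two, ← pow_mul, mul_comm, pow_mul, hφ, one_pow]
  have h2 : r ≠ 2 := by
    have : 1 < Fintype.card F := Fintype.one_lt_card
    omega
  obtain ⟨k, hk⟩ := hr.odd_of_ne_two h2
  rw [hk, pow_succ, pow_mul, pow_two, h1, one_pow, one_mul] at hφ
  exact hφ

end Main

section Degree

variable {n : ℕ} {F : Type*} [Field F] [Fintype F]

lemma sq_le_card_E (hn : 3 ≤ n) :
    Fintype.card F ^ 2 ≤ Nat.card (E (Pi.single ⟨0, by omega⟩ 1 : Fin n → F)) := by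
  classical
  set i0 : Fin n := ⟨0, by omega⟩
  let i1 : Fin n := ⟨1, by omega⟩
  let i2 : Fin n := ⟨2, by omega⟩
  have h1 : i1 ≠ i0 := by simp [i0, i1]
  have h2 : i2 ≠ i0 := by simp [i0, i2]
  have h12 : i2 ≠ i1 := by simp [i1, i2]
  let f : F × F → (Fin n → F) := fun a => Pi.single i1 a.1 + Pi.single i2 a.2
  have hf : ∀ a, f a ⬝ᵥ (Pi.single i0 1 : Fin n → F) = 0 := by
    intro a
    simp [f, h1.symm, h2.symm]
  let g : F × F → E (Pi.single i0 1 : Fin n → F) := fun a => ⟨_, f a, hf a, rfl⟩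
  have hg : Function.Injective g := by
    intro a b e
    have e1 := pr_tv_inj hn (congrArg Subtype.val e)
    have e2 := congrFun (congrFun e1 i0) i1
    have e3 := congrFun (congrFun e1 i0) i2
    simp only [vecMulVec_apply, f, Pi.single_eq_same, Pi.add_apply, one_mul,
      Pi.single_eq_of_ne h12.symm, Pi.single_eq_of_ne h12, add_zero, zero_add] at e2 e3
    exact Prod.ext e2 e3
  have := Nat.card_le_card_of_injective g hg
  rwa [Nat.card_eq_fintype_card, Fintype.card_prod, ← pow_two] at this

/-- permutation degree bound -/
lemma degree_bound (hn : 3 ≤ n) {P : Type*} [Fintype P] (ρ : PS n F →* Equiv.Perm P)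
    (hρ : Function.Injective ρ) : Fintype.card F ^ 2 ≤ Fintype.card P := by
  classical
  refine (sq_le_card_E (F := F) hn).trans ?_
  set u : Fin n → F := Pi.single ⟨0, by omega⟩ 1 with hu
  have hu0 : u ≠ 0 := by
    intro h
    have := congrFun h ⟨0, by omega⟩
    simp [hu] at this
  let fx : PS n F → ℕ := fun x => (Finset.univ.filter fun a : P => ρ x a = a).card
  have hconj : ∀ x y, IsConj x y → fx x = fx y := by
    intro x y hxy
    obtain ⟨g, rfl⟩ := isConj_iff.1 hxy
    refine Finset.card_bij (fun a _ => ρ g a) ?_ (fun a _ b _ e => (ρ g).injective e) ?_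
    · intro a ha
      simp only [Finset.mem_filter, Finset.mem_univ, true_and] at ha ⊢
      simp [ha]
    · intro b hb
      simp only [Finset.mem_filter, Finset.mem_univ, true_and] at hb ⊢
      refine ⟨(ρ g)⁻¹ b, ?_, by simp⟩
      rw [Equiv.Perm.eq_inv_iff_eq]
      simpa using hb
  obtain ⟨x0, hx01⟩ := Subgroup.ne_bot_iff_exists_ne_one.1 (E_ne_bot hn hu0)
  have hx01' : (x0 : PS n F) ≠ 1 := fun h => hx01 (Subtype.ext h)
  have hT0 := isT_of_mem_E hu0 x0.2 hx01'
  have hfx : ∀ x : E u, x ≠ 1 → fx x = fx x0 := by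
    intro x hx
    exact hconj _ _ ((isT_of_mem_E hu0 x.2 fun h => hx (Subtype.ext h)).isConj hn hT0)
  have hfx1 : fx 1 = Fintype.card P := by simp [fx]
  have hlt : fx x0 < Fintype.card P := by
    rw [← Finset.card_univ]
    apply Finset.card_lt_card
    rw [Finset.filter_ssubset]
    by_contra hcon
    push Not at hcon
    apply hx01'
    apply hρ
    rw [map_one]
    ext a
    exact hcon a (Finset.mem_univ a)
  letI : MulAction (E u) P := MulAction.compHom P (ρ.comp (E u).subtype)
  letI : Fintype (E u) := Fintype.ofFinite _
  have hb := MulAction.sum_card_fixedBy_eq_card_orbits_mul_card_group (E u) P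
  have hterm : ∀ x : E u, Fintype.card (MulAction.fixedBy P x) = fx x := by
    intro x
    exact Fintype.card_subtype _
  rw [Finset.sum_congr rfl fun x _ => hterm x,
    ← Finset.add_sum_erase _ _ (Finset.mem_univ (1 : E u)),
    Finset.sum_congr rfl (g := fun _ => fx x0) (fun x hx => hfx x (Finset.ne_of_mem_erase hx)),
    Finset.sum_const, Finset.card_erase_of_mem (Finset.mem_univ _), Finset.card_univ,
    Subgroup.coe_one, hfx1, smul_eq_mul] at hb
  rw [Nat.card_eq_fintype_card]
  set N := Fintype.card (E u)
  have hN : 1 ≤ N := Fintype.card_pos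
  obtain ⟨M, hM⟩ : ∃ M, N = M + 1 := ⟨N - 1, by omega⟩
  set o := Fintype.card (Quotient (MulAction.orbitRel (E u) P))
  rw [hM] at hb ⊢
  simp only [Nat.add_sub_cancel] at hb
  -- v + M f = o (M+1), f < v
  have ho : fx x0 < o := by
    by_contra hcon
    push Not at hcon
    have := Nat.mul_le_mul_right (M + 1) hcon
    nlinarith
  nlinarith [Nat.mul_le_mul_right (M + 1) (Nat.succ_le_of_lt ho)]

end Degree

section Design

variable {P : Type*} [Fintype P] [DecidableEq P]

/-- counting flags through a point inside a set of points -/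
lemma count_through {blocks : Finset (Finset P)} {v k lam r : ℕ}
    (hD : IsTwoDesign blocks v k lam) (hrepl : ∀ x : P, pointDegree blocks x = r)
    (α : P) (D : Finset P) (hα : α ∈ D) (t : ℕ)
    (ht : ∀ B ∈ blocks, α ∈ B → (B ∩ D).card = t) : r * (t - 1) = lam * (D.card - 1) := by
  obtain ⟨_, _, _, _, hpair⟩ := hD
  have h := Finset.sum_card_bipartiteAbove_eq_sum_card_bipartiteBelow
    (s := blocks.filter fun B => α ∈ B) (t := D.erase α) (fun B y => y ∈ B)
  have h1 : ∀ B ∈ blocks.filter (fun B => α ∈ B),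
      ((D.erase α).bipartiteAbove (fun B y => y ∈ B) B).card = t - 1 := by
    intro B hB
    obtain ⟨hB, hαB⟩ := Finset.mem_filter.1 hB
    rw [← ht B hB hαB, ← Finset.card_erase_of_mem (Finset.mem_inter.2 ⟨hαB, hα⟩)]
    congr 1
    ext y
    simp only [Finset.mem_bipartiteAbove, Finset.mem_erase, Finset.mem_inter]
    tauto
  have h2 : ∀ y ∈ D.erase α,
      ((blocks.filter fun B => α ∈ B).bipartiteBelow (fun B y => y ∈ B) y).card = lam := by
    intro y hy
    rw [← hpair α y (Finset.ne_of_mem_erase hy).symm]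
    congr 1
    ext B
    simp only [Finset.mem_bipartiteBelow, Finset.mem_filter]
    tauto
  rw [Finset.sum_congr rfl h1, Finset.sum_congr rfl h2, Finset.sum_const, Finset.sum_const,
    smul_eq_mul, smul_eq_mul, Finset.card_erase_of_mem hα] at h
  have h3 := hrepl α
  unfold pointDegree at h3
  rw [h3] at h
  rw [h, mul_comm]

lemma count_flags {blocks : Finset (Finset P)} {v k lam r : ℕ}
    (hD : IsTwoDesign blocks v k lam) (hrepl : ∀ x : P, pointDegree blocks x = r) :
    blocks.card * k = v * r := by
  obtain ⟨hv, _, _, hk, _⟩ := hD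
  have h := Finset.sum_card_bipartiteAbove_eq_sum_card_bipartiteBelow
    (s := blocks) (t := (Finset.univ : Finset P)) (fun B y => y ∈ B)
  have h1 : ∀ B ∈ blocks,
      ((Finset.univ : Finset P).bipartiteAbove (fun B y => y ∈ B) B).card = k := by
    intro B hB
    rw [← hk B hB]
    congr 1
    ext y
    simp [Finset.mem_bipartiteAbove]
  have h2 : ∀ y ∈ (Finset.univ : Finset P),
      (blocks.bipartiteBelow (fun B y => y ∈ B) y).card = r := by
    intro y _
    exact hrepl y
  rw [Finset.sum_congr rfl h1, Finset.sum_congr rfl h2, Finset.sum_const, Finset.sum_const,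
    smul_eq_mul, smul_eq_mul, Finset.card_univ, hv] at h
  exact h

lemma fisher {blocks : Finset (Finset P)} {v k lam r : ℕ}
    (hD : IsTwoDesign blocks v k lam) (hrepl : ∀ x : P, pointDegree blocks x = r)
    (hlr : lam < r) : v ≤ blocks.card := by
  obtain ⟨hv, hv2, hl1, hk, hpair⟩ := hD
  let T : (P → ℚ) →ₗ[ℚ] (blocks → ℚ) :=
    { toFun := fun f B => ∑ x ∈ (B : Finset P), f x
      map_add' := by intro f g; funext B; simp [Finset.sum_add_distrib]
      map_smul' := by intro c f; funext B; simp [Finset.mul_sum] }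
  have hT : Function.Injective T := by
    rw [← LinearMap.ker_eq_bot, LinearMap.ker_eq_bot']
    intro f hf
    have hB : ∀ B ∈ blocks, ∑ x ∈ B, f x = 0 := fun B hB => congrFun hf ⟨B, hB⟩
    set S := ∑ y, f y with hS
    have hx : ∀ x, ((r : ℚ) - lam) * f x + lam * S = 0 := by
      intro x
      have h0 : ∑ B ∈ blocks.filter (fun B => x ∈ B), ∑ y ∈ B, f y = 0 :=
        Finset.sum_eq_zero fun B hB' => hB B (Finset.mem_filter.1 hB').1
      have h1 : ∑ B ∈ blocks.filter (fun B => x ∈ B), ∑ y ∈ B, f y =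
          ∑ y, ((blocks.filter fun B => x ∈ B ∧ y ∈ B).card : ℚ) * f y := by
        have e : ∀ B ∈ blocks.filter (fun B => x ∈ B), ∑ y ∈ B, f y =
            ∑ y, if y ∈ B then f y else 0 := by
          intro B _
          rw [← Finset.sum_filter]
          congr 1
          ext y; simp
        rw [Finset.sum_congr rfl e, Finset.sum_comm]
        apply Finset.sum_congr rfl
        intro y _
        rw [← Finset.sum_filter, Finset.sum_const, Finset.filter_filter, nsmul_eq_mul]
      rw [h1, ← Finset.add_sum_erase _ _ (Finset.mem_univ x)] at h0
      have h2 : ∑ y ∈ Finset.univ.erase x,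
          ((blocks.filter fun B => x ∈ B ∧ y ∈ B).card : ℚ) * f y = lam * (S - f x) := by
        rw [hS, ← Finset.add_sum_erase _ _ (Finset.mem_univ x), add_sub_cancel_left,
          Finset.mul_sum]
        apply Finset.sum_congr rfl
        intro y hy
        rw [hpair x y (Finset.ne_of_mem_erase hy).symm]
      have h3 : (blocks.filter fun B => x ∈ B ∧ x ∈ B).card = r := by
        simp only [and_self]
        exact hrepl x
      rw [h2, h3] at h0
      linarith
    have hrl : (0 : ℚ) < (r : ℚ) - lam := by
      have : (lam : ℚ) < r := by exact_mod_cast hlr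
      linarith
    have hS0 : S = 0 := by
      have h1 : ∑ x : P, (((r : ℚ) - lam) * f x + lam * S) = 0 :=
        Finset.sum_eq_zero fun x _ => hx x
      rw [Finset.sum_add_distrib, ← Finset.mul_sum, Finset.sum_const, Finset.card_univ,
        nsmul_eq_mul] at h1
      have h2 : ((r : ℚ) - lam + Fintype.card P * lam) * S = 0 := by
        rw [← h1]; ring
      rcases mul_eq_zero.1 h2 with h3 | h3
      · have : (0 : ℚ) ≤ Fintype.card P * lam := by positivity
        linarith
      · exact h3
    funext x
    have := hx x
    rw [hS0, mul_zero, add_zero] at this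
    exact (mul_eq_zero.1 this).resolve_left hrl.ne'
  have := LinearMap.finrank_le_finrank_of_injective hT
  rw [Module.finrank_fintype_fun_eq_card, Module.finrank_fintype_fun_eq_card,
    Fintype.card_coe, hv] at this
  exact this

lemma arith {blocks : Finset (Finset P)} {v k lam r : ℕ}
    (hD : IsTwoDesign blocks v k lam) (hk : 2 < k) (hkv : k < v - 1)
    (hrepl : ∀ x : P, pointDegree blocks x = r) (α : P) :
    lam < r ∧ v < r ^ 2 ∧ r * (k - 1) = lam * (v - 1) := by
  have h1 : r * (k - 1) = lam * (v - 1) := by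
    have := count_through hD hrepl α Finset.univ (Finset.mem_univ _) k (by
      intro B hB _
      rw [Finset.inter_univ]
      exact hD.2.2.2.1 B hB)
    rwa [Finset.card_univ, hD.1] at this
  have hl := hD.2.2.1
  have hlr : lam < r := by
    by_contra hcon
    push Not at hcon
    have h2 : r * (k - 1) ≤ lam * (k - 1) := Nat.mul_le_mul_right _ hcon
    have h3 : lam * (k - 1) < lam * (v - 1) := Nat.mul_lt_mul_of_pos_left (by omega) (by omega)
    omega
  have hf := fisher hD hrepl hlr
  have hb := count_flags hD hrepl
  have hkr : k ≤ r := by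
    have : v * k ≤ v * r := hb ▸ Nat.mul_le_mul_right k hf
    exact Nat.le_of_mul_le_mul_left this (by omega)
  refine ⟨hlr, ?_, h1⟩
  have h4 : v - 1 ≤ r * (k - 1) := by rw [h1]; exact Nat.le_mul_of_pos_left _ (by omega)
  have h5 : r * (k - 1) ≤ r * (r - 1) := Nat.mul_le_mul_left _ (by omega)
  obtain ⟨s, rfl⟩ : ∃ s, r = s + 1 := ⟨r - 1, by omega⟩
  simp only [Nat.add_sub_cancel] at h5
  have : v ≤ (s + 1) * s + 1 := by omega
  nlinarith [show 1 ≤ s by omega]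

lemma exists_block {blocks : Finset (Finset P)} {r : ℕ} (hr : 0 < r)
    (hrepl : ∀ x : P, pointDegree blocks x = r) (x : P) : ∃ B ∈ blocks, x ∈ B := by
  have h := hrepl x
  unfold pointDegree at h
  have : 0 < (blocks.filter fun B => x ∈ B).card := by omega
  obtain ⟨B, hB⟩ := Finset.card_pos.1 this
  exact ⟨B, Finset.mem_filter.1 hB⟩

/-- `r` divides the order of the point stabilizer -/
lemma r_dvd_stab {blocks : Finset (Finset P)} {r : ℕ} (hr : 0 < r)
    (hrepl : ∀ x : P, pointDegree blocks x = r) (G : Subgroup (Equiv.Perm P))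
    (hAut : IsAutGroup blocks G) (hFT : IsFlagTransitive blocks G) (α : P) :
    r ∣ Nat.card (MulAction.stabilizer G α) := by
  obtain ⟨B, hB, hαB⟩ := exists_block hr hrepl α
  have horb : MulAction.orbit (MulAction.stabilizer G α) B =
      ((blocks.filter fun B => α ∈ B : Finset (Finset P)) : Set (Finset P)) := by
    ext C
    rw [MulAction.mem_orbit_iff, Finset.mem_coe, Finset.mem_filter]
    constructor
    · rintro ⟨g, rfl⟩
      refine ⟨hAut _ g.1.2 B hB, ?_⟩
      have h1 : g.1 • α = α := g.2
      have h2 : g • α ∈ g • B := Finset.smul_mem_smul_finset hαB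
      have h3 : g • α = α := h1
      rwa [h3] at h2
    · rintro ⟨hC, hαC⟩
      obtain ⟨g, hg, h1, h2⟩ := hFT B hB C hC α hαB α hαC
      exact ⟨⟨⟨g, hg⟩, h1⟩, h2⟩
  have h1 := MulAction.index_stabilizer (MulAction.stabilizer G α) B
  rw [horb, Set.ncard_coe_finset] at h1
  have h2 := hrepl α
  unfold pointDegree at h2
  rw [← h2, ← h1]
  exact Subgroup.index_dvd_card _

/-- the socle is transitive -/
lemma socle_transitive {blocks : Finset (Finset P)} {v k lam r : ℕ}
    (hD : IsTwoDesign blocks v k lam) (hk : 2 < k) (hkv : k < v - 1)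
    (hr : r.Prime) (hrepl : ∀ x : P, pointDegree blocks x = r)
    (G : Subgroup (Equiv.Perm P))
    (hFT : IsFlagTransitive blocks G)
    (X : Subgroup G) (hXnormal : X.Normal) (hX : X ≠ ⊥) (α : P) :
    ∀ β : P, ∃ x : G, x ∈ X ∧ x • α = β := by
  classical
  obtain ⟨hlr, hvr, hrk⟩ := arith hD hk hkv hrepl α
  obtain ⟨hv, _, hl, _, _⟩ := id hD
  let O : P → Finset P := fun y => Finset.univ.filter fun z => ∃ x : G, x ∈ X ∧ x • y = z
  have memO : ∀ y z, z ∈ O y ↔ ∃ x : G, x ∈ X ∧ x • y = z := by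
    intro y z; simp [O]
  have hself : ∀ y, y ∈ O y := fun y => (memO y y).2 ⟨1, X.one_mem, one_smul _ _⟩
  have hOeq : ∀ y z, z ∈ O y → O z = O y := by
    intro y z hz
    obtain ⟨x, hx, rfl⟩ := (memO _ _).1 hz
    ext w
    rw [memO, memO]
    constructor
    · rintro ⟨x', hx', rfl⟩
      exact ⟨x' * x, X.mul_mem hx' hx, mul_smul _ _ _⟩
    · rintro ⟨x', hx', rfl⟩
      exact ⟨x' * x⁻¹, X.mul_mem hx' (X.inv_mem hx), by rw [mul_smul, inv_smul_smul]⟩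
  have hOg : ∀ (g : G) y z, z ∈ O y → g • z ∈ O (g • y) := by
    intro g y z hz
    obtain ⟨x, hx, rfl⟩ := (memO _ _).1 hz
    refine (memO _ _).2 ⟨g * x * g⁻¹, hXnormal.conj_mem x hx g, ?_⟩
    rw [mul_smul, mul_smul, inv_smul_smul]
  have htrans : ∀ y z : P, ∃ g : G, g • y = z := by
    intro y z
    obtain ⟨B, hB, hy⟩ := exists_block hr.pos hrepl y
    obtain ⟨C, hC, hz⟩ := exists_block hr.pos hrepl z
    obtain ⟨g, hg, h1, _⟩ := hFT B hB C hC y hy z hz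
    exact ⟨⟨g, hg⟩, h1⟩
  set c := (O α).card with hc
  have hle : ∀ y z, (O y).card ≤ (O z).card := by
    intro y z
    obtain ⟨g, rfl⟩ := htrans y z
    exact Finset.card_le_card_of_injOn (fun a => g • a) (fun a ha => hOg g y a ha)
      (fun a _ b _ e => smul_left_cancel g e)
  have hcard : ∀ y, (O y).card = c := fun y => le_antisymm (hle _ _) (hle _ _)
  -- partition
  have hpart : v = (Finset.univ.image O).card * c := by
    rw [← hv, ← Finset.card_univ, Finset.card_eq_sum_card_image O Finset.univ,
      ← smul_eq_mul, ← Finset.sum_const]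
    apply Finset.sum_congr rfl
    intro K hK
    obtain ⟨y, _, rfl⟩ := Finset.mem_image.1 hK
    rw [← hcard y]
    congr 1
    ext z
    simp only [Finset.mem_filter, Finset.mem_univ, true_and]
    exact ⟨fun h => h ▸ hself z, fun h => hOeq y z h⟩
  have hc1 : c ≠ 1 := by
    intro h1
    apply hX
    rw [eq_bot_iff]
    intro x hx
    rw [Subgroup.mem_bot]
    apply Subtype.ext
    ext y
    have h2 : x • y ∈ O y := (memO _ _).2 ⟨x, hx, rfl⟩
    obtain ⟨a, ha⟩ := Finset.card_eq_one.1 ((hcard y).trans h1)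
    have h3 := hself y
    rw [ha, Finset.mem_singleton] at h2 h3
    exact h2.trans h3.symm
  have hc0 : 0 < c := Finset.card_pos.2 ⟨α, hself α⟩
  -- intersection numbers
  obtain ⟨B0, hB0, hαB0⟩ := exists_block hr.pos hrepl α
  have hr1 : r * ((B0 ∩ O α).card - 1) = lam * (c - 1) := by
    apply count_through hD hrepl α (O α) (hself α)
    have le : ∀ B ∈ blocks, ∀ C ∈ blocks, α ∈ B → α ∈ C →
        (B ∩ O α).card ≤ (C ∩ O α).card := by
      intro B hB C hC hαB hαC
      obtain ⟨g, hg, h1, h2⟩ := hFT B hB C hC α hαB α hαC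
      refine Finset.card_le_card_of_injOn g ?_ (fun a _ b _ e => g.injective e)
      intro y hy
      obtain ⟨hyB, hyO⟩ := Finset.mem_inter.1 hy
      refine Finset.mem_coe.2 (Finset.mem_inter.2 ⟨h2 ▸ Finset.mem_image_of_mem _ hyB, ?_⟩)
      have h3 := hOg ⟨g, hg⟩ α y hyO
      have h4 : (⟨g, hg⟩ : G) • α = α := h1
      rw [h4] at h3
      exact h3
    intro B hB hαB
    exact le_antisymm (le _ hB _ hB0 hαB hαB0) (le _ hB0 _ hB hαB0 hαB)
  have dvd_of : ∀ m, r ∣ lam * m → r ∣ m := by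
    intro m hm
    rcases (Nat.Prime.dvd_mul hr).1 hm with h | h
    · have := Nat.le_of_dvd hl h
      omega
    · exact h
  obtain ⟨a, ha⟩ := dvd_of _ ⟨_, hr1.symm⟩
  obtain ⟨b, hb⟩ := dvd_of _ ⟨_, hrk.symm⟩
  have hcr : r + 1 ≤ c := by
    have : a ≠ 0 := by rintro rfl; omega
    have : r * 1 ≤ r * a := Nat.mul_le_mul_left _ (by omega)
    omega
  set m := (Finset.univ.image O).card with hm
  have hmr : m < r := by
    by_contra hcon
    push Not at hcon
    have : r * (r + 1) ≤ m * c := Nat.mul_le_mul hcon hcr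
    nlinarith
  have hm1 : m = 1 := by
    have hm0 : m ≠ 0 := by
      intro h0
      rw [h0] at hpart
      omega
    have h1 : m ≡ 1 [MOD r] := by
      have e1 : c ≡ 1 [MOD r] := by
        have : c = 1 + r * a := by omega
        rw [this]
        simp [Nat.ModEq]
      have e2 : v ≡ 1 [MOD r] := by
        have : v = 1 + r * b := by omega
        rw [this]
        simp [Nat.ModEq]
      rw [hpart] at e2
      have e3 := (Nat.ModEq.refl m).mul e1 (n := r)
      rw [mul_one] at e3
      exact e3.symm.trans e2
    exact Nat.ModEq.eq_of_lt_of_lt h1 hmr hr.one_lt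
  rw [hm1, one_mul] at hpart
  have huniv : O α = Finset.univ := by
    rw [← Finset.card_eq_iff_eq_univ, hv, hpart]
  intro β
  exact (memO α β).1 (huniv ▸ Finset.mem_univ β)

lemma pPrimePart_dvd {p r m : ℕ} (hp : p.Prime) (hr : r.Prime) (hne : r ≠ p) (h : r ∣ m) :
    r ∣ pPrimePart p m := by
  unfold pPrimePart
  rw [← Nat.ordProj_mul_ordCompl_eq_self m p] at h
  refine (Nat.Coprime.dvd_of_dvd_mul_left ?_ h)
  exact Nat.Coprime.pow_right _ ((Nat.coprime_primes hr hp).2 hne)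

end Design


end PSLAux

/-- If `D` is a nontrivial 2-design with prime replication number `r`, `G` is a
flag-transitive automorphism group of `D` which is almost simple with socle
`X ≅ PSLₙ(F)` (`n ≥ 3`, `F` of characteristic `p`), and `α` is a point, then `r`
divides the `p′`-part of `|G_α ∩ X|` and `|X| < |G_α ∩ X| ⬝ (|G_α ∩ X|_{p′})²`. -/
theorem replication_dvd_p_regular_part [Fintype P] [DecidableEq P]
    (blocks : Finset (Finset P)) (v k lam r : ℕ)
    (hD : IsTwoDesign blocks v k lam) (hk : 2 < k) (hkv : k < v - 1)
    (hr : r.Prime) (hrepl : ∀ x : P, pointDegree blocks x = r)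
    (G : Subgroup (Equiv.Perm P)) (hAut : IsAutGroup blocks G)
    (hFT : IsFlagTransitive blocks G)
    (X : Subgroup G) (hXnormal : X.Normal) (hXsimple : IsSimpleGroup X)
    (hXnonabelian : ∃ a b : X, a * b ≠ b * a)
    (hXcent : Subgroup.centralizer (X : Set G) = ⊥)
    (n : ℕ) (hn : 3 ≤ n) (F : Type*) [Field F] [Fintype F]
    (p : ℕ) (hp : p.Prime) [CharP F p]
    (hiso : Nonempty (X ≃* (Matrix.SpecialLinearGroup (Fin n) F ⧸
      Subgroup.center (Matrix.SpecialLinearGroup (Fin n) F))))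
    (α : P) :
    r ∣ pPrimePart p (Nat.card (MulAction.stabilizer G α ⊓ X : Subgroup G)) ∧
      Nat.card X <
        Nat.card (MulAction.stabilizer G α ⊓ X : Subgroup G) *
          (pPrimePart p (Nat.card (MulAction.stabilizer G α ⊓ X : Subgroup G))) ^ 2 := by
  classical
  have := Fact.mk hp
  have := Fact.mk hr
  obtain ⟨e⟩ := hiso
  obtain ⟨hlr, hvr, hrk⟩ := PSLAux.arith hD hk hkv hrepl α
  have hXb : X ≠ ⊥ := by
    rintro rfl
    obtain ⟨a, b, hab⟩ := hXnonabelian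
    exact hab (Subsingleton.elim _ _)
  have htr := PSLAux.socle_transitive hD hk hkv hr hrepl G hFT X hXnormal hXb α
  -- the order of `X`
  have hcard : Nat.card X = v * Nat.card (MulAction.stabilizer G α ⊓ X : Subgroup G) := by
    have h1 := MulAction.index_stabilizer X α
    have h2 : MulAction.orbit X α = Set.univ := by
      rw [Set.eq_univ_iff_forall]
      intro β
      obtain ⟨x, hx, h⟩ := htr β
      exact ⟨⟨x, hx⟩, h⟩
    rw [h2, Set.ncard_univ, Nat.card_eq_fintype_card, hD.1] at h1
    have h3 : Nat.card (MulAction.stabilizer X α) =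
        Nat.card (MulAction.stabilizer G α ⊓ X : Subgroup G) :=
      Nat.card_congr ⟨fun g => ⟨g.1.1, g.2, g.1.2⟩, fun g => ⟨⟨g.1, g.2.2⟩, g.2.1⟩,
        fun _ => rfl, fun _ => rfl⟩
    rw [← h3, ← h1, mul_comm]
    exact (Subgroup.card_mul_index _).symm
  -- `q < r`
  have hq : Fintype.card F < r := by
    have h1 : Fintype.card F ^ 2 ≤ Fintype.card P :=
      PSLAux.degree_bound hn ((G.subtype.comp X.subtype).comp e.symm.toMonoidHom)
        ((G.subtype_injective.comp X.subtype_injective).comp e.symm.injective)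
    rw [hD.1] at h1
    exact lt_of_pow_lt_pow_left₀ 2 (Nat.zero_le _) (h1.trans_lt hvr)
  have hrp : r ≠ p := by
    rintro rfl
    obtain ⟨m, _, hm⟩ := FiniteField.card F r
    have : r ^ 1 ≤ r ^ (m : ℕ) := Nat.pow_le_pow_right hr.pos m.pos
    rw [pow_one, ← hm] at this
    omega
  have hrv : ¬ r ∣ v := by
    intro h
    have h1 : r ∣ lam * (v - 1) := ⟨_, hrk.symm⟩
    rcases (Nat.Prime.dvd_mul hr).1 h1 with h2 | h2
    · have := Nat.le_of_dvd hD.2.2.1 h2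
      omega
    · have h3 := (Nat.dvd_sub h h2)
      have h4 : v - (v - 1) = 1 := by omega
      rw [h4] at h3
      exact hr.one_lt.ne' (Nat.dvd_one.1 h3)
  have hdvd : r ∣ Nat.card (MulAction.stabilizer G α ⊓ X : Subgroup G) := by
    by_contra hcon
    have hX : ¬ r ∣ Nat.card X := by
      rw [hcard, Nat.Prime.dvd_mul hr]
      tauto
    have hG : r ∣ Nat.card G :=
      (PSLAux.r_dvd_stab hr.pos hrepl G hAut hFT α).trans (Subgroup.card_subgroup_dvd_card _)
    obtain ⟨σ, hσ⟩ := exists_prime_orderOf_dvd_card' r hG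
    have hφ : MulAut.congr e (MulAut.conjNormal σ) = 1 := by
      apply PSLAux.aut_eq_one hn p hr hq
      · rwa [← Nat.card_congr e.toEquiv]
      · rw [← map_pow, ← map_pow, ← hσ, pow_orderOf_eq_one, map_one, map_one]
    rw [MulEquiv.map_eq_one_iff] at hφ
    have hc : σ ∈ Subgroup.centralizer (X : Set G) := by
      rw [Subgroup.mem_centralizer_iff]
      intro x hx
      have h1 := congrArg Subtype.val (DFunLike.congr_fun hφ ⟨x, hx⟩)
      rw [MulAut.conjNormal_apply] at h1
      exact (mul_inv_eq_iff_eq_mul.1 h1).symm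
    rw [hXcent, Subgroup.mem_bot] at hc
    rw [hc, orderOf_one] at hσ
    exact hr.one_lt.ne hσ
  have hres := PSLAux.pPrimePart_dvd hp hr hrp hdvd
  have hpos : 0 < Nat.card (MulAction.stabilizer G α ⊓ X : Subgroup G) := Nat.card_pos
  refine ⟨hres, ?_⟩
  have hpp : 0 < pPrimePart p (Nat.card (MulAction.stabilizer G α ⊓ X : Subgroup G)) :=
    Nat.ordCompl_pos p hpos.ne'
  rw [hcard, mul_comm]
  apply Nat.mul_lt_mul_of_pos_left _ hpos
  exact hvr.trans_le (Nat.pow_le_pow_left (Nat.le_of_dvd hpp hres) 2)
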